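/- Let f, g ∈ ℂ[x] be polynomials with deg f ≠ deg g and with Prep(f) = Prep(g), and let c ∈ ℂ be a point belonging to Prep(f). Then the set { n ∈ ℕ : there exists x ∈ ℂ with f^n(x) = c and g^n(x) = c } is a finite union of arithmetic progressions. -/

import Mathlib

section Helpers
open Filter Topology Polynomial

namespace Stmt15

/-- Leading-term asymptotics along a sequence tending to infinity. -/
lemma tendsto_div_pow (p : ℂ[X]) (z : ℕ → ℂ) (hz : Tendsto (fun k => ‖z k‖) atTop atTop) :
    Tendsto (fun k => p.eval (z k) / (z k) ^ p.natDegree) atTop (𝓝 p.leadingCoeff) := by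
  have h0 : Tendsto (fun k => (z k)⁻¹) atTop (𝓝 0) := by
    have := tendsto_inv₀_cobounded (α := ℂ)
    exact this.comp (tendsto_norm_atTop_iff_cobounded.mp hz)
  have h1 : Tendsto (fun k => p.reverse.eval (z k)⁻¹) atTop (𝓝 (p.reverse.eval 0)) :=
    (p.reverse.continuous.tendsto 0).comp h0
  have h2 : p.reverse.eval 0 = p.leadingCoeff := by
    rw [← coeff_zero_eq_eval_zero, coeff_zero_reverse]
  rw [h2] at h1
  refine h1.congr' ?_
  filter_upwards [hz.eventually_gt_atTop 0] with k hk
  have hne : z k ≠ 0 := norm_pos_iff.mp hk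
  letI := invertibleOfNonzero hne
  have := eval₂_reverse_mul_pow (RingHom.id ℂ) (z k) p
  rw [invOf_eq_inv] at this
  rw [eq_div_iff (pow_ne_zero _ hne)]
  simpa [eval₂_id] using this

lemma tendsto_eval_atTop (p : ℂ[X]) (hp : 0 < p.natDegree) (z : ℕ → ℂ)
    (hz : Tendsto (fun k => ‖z k‖) atTop atTop) :
    Tendsto (fun k => ‖p.eval (z k)‖) atTop atTop :=
  p.tendsto_norm_atTop (natDegree_pos_iff_degree_pos.mp hp) hz

lemma tendsto_of_eval_atTop (p : ℂ[X]) (z : ℕ → ℂ)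
    (hz : Tendsto (fun k => ‖p.eval (z k)‖) atTop atTop) :
    Tendsto (fun k => ‖z k‖) atTop atTop := by
  rw [tendsto_norm_atTop_iff_cobounded, Metric.cobounded_eq_cocompact, Filter.tendsto_def]
  intro s hs
  obtain ⟨t, ht, hts⟩ := Filter.mem_cocompact.mp hs
  obtain ⟨C, hC⟩ := (ht.image p.continuous).isBounded.exists_norm_le
  filter_upwards [hz.eventually_gt_atTop C] with k hk
  by_contra hcon
  have : z k ∈ t := by
    by_contra h
    exact hcon (hts h)
  exact absurd (hC _ ⟨_, this, rfl⟩) (not_le.mpr hk)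

/-- Points of the same fibre with ratio tending to `1` are eventually equal. -/
lemma eventually_eq_of_ratio (p : ℂ[X]) (hp : 0 < p.natDegree) (w w' : ℕ → ℂ)
    (hw : Tendsto (fun k => ‖w' k‖) atTop atTop)
    (hr : Tendsto (fun k => w k / w' k) atTop (𝓝 1))
    (he : ∀ᶠ k in atTop, p.eval (w k) = p.eval (w' k)) :
    ∀ᶠ k in atTop, w k = w' k := by
  set D := p.natDegree with hD
  have h0 : Tendsto (fun k => (w' k)⁻¹) atTop (𝓝 0) :=
    (tendsto_inv₀_cobounded (α := ℂ)).comp (tendsto_norm_atTop_iff_cobounded.mp hw)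
  -- the normalized difference quotient
  have hlim : Tendsto (fun k => ∑ i ∈ Finset.range (D + 1),
      p.coeff i * ((w' k)⁻¹) ^ (D - i) * ∑ j ∈ Finset.range i, (w k / w' k) ^ j) atTop
      (𝓝 (∑ i ∈ Finset.range (D + 1), p.coeff i * (0 : ℂ) ^ (D - i) *
        ∑ j ∈ Finset.range i, (1 : ℂ) ^ j)) := by
    refine tendsto_finsetSum _ fun i _ => ?_
    refine (tendsto_const_nhds.mul (h0.pow _)).mul ?_
    exact tendsto_finsetSum _ fun j _ => hr.pow j
  have hval : (∑ i ∈ Finset.range (D + 1), p.coeff i * (0 : ℂ) ^ (D - i) *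
        ∑ j ∈ Finset.range i, (1 : ℂ) ^ j) = p.leadingCoeff * D := by
    rw [Finset.sum_range_succ, Finset.sum_eq_zero]
    · simp [hD]
    · intro i hi
      have : D - i ≠ 0 := by
        have := Finset.mem_range.mp hi
        omega
      simp [this]
  rw [hval] at hlim
  have hne : p.leadingCoeff * (D : ℂ) ≠ 0 := by
    have : p ≠ 0 := by
      rintro rfl
      simp at hD
      omega
    exact mul_ne_zero (leadingCoeff_ne_zero.mpr this) (by exact_mod_cast hp.ne')
  filter_upwards [hlim.eventually_ne hne, he, hw.eventually_gt_atTop 0] with k hk hek hwk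
  have hw0 : w' k ≠ 0 := norm_pos_iff.mp hwk
  by_contra hcon
  apply hk
  have hkey : (w k / w' k - 1) * (∑ i ∈ Finset.range (D + 1),
      p.coeff i * ((w' k)⁻¹) ^ (D - i) * ∑ j ∈ Finset.range i, (w k / w' k) ^ j) = 0 := by
    rw [Finset.mul_sum]
    have : ∀ i ∈ Finset.range (D + 1), (w k / w' k - 1) * (p.coeff i * ((w' k)⁻¹) ^ (D - i) *
        ∑ j ∈ Finset.range i, (w k / w' k) ^ j) =
        ((w' k)⁻¹) ^ D * (p.coeff i * (w k) ^ i - p.coeff i * (w' k) ^ i) := by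
      intro i hi
      have hi' : i ≤ D := by
        have := Finset.mem_range.mp hi
        omega
      have hg := geom_sum_mul (w k / w' k) i
      calc _ = p.coeff i * ((w' k)⁻¹) ^ (D - i) *
            ((∑ j ∈ Finset.range i, (w k / w' k) ^ j) * (w k / w' k - 1)) := by ring
        _ = p.coeff i * ((w' k)⁻¹) ^ (D - i) * ((w k / w' k) ^ i - 1) := by rw [hg]
        _ = _ := by
          have h3 : ((w' k)⁻¹) ^ D = ((w' k)⁻¹) ^ (D - i) * ((w' k)⁻¹) ^ i := by
            rw [← pow_add, Nat.sub_add_cancel hi']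
          have h4 : ((w' k)⁻¹) ^ i * (w k ^ i - w' k ^ i) = (w k / w' k) ^ i - 1 := by
            rw [mul_sub, ← mul_pow, ← mul_pow, inv_mul_cancel₀ hw0, one_pow, inv_mul_eq_div]
          rw [h3, ← h4]
          ring
    rw [Finset.sum_congr rfl this, ← Finset.mul_sum, Finset.sum_sub_distrib,
      ← eval_eq_sum_range, ← eval_eq_sum_range, hek, sub_self, mul_zero]
  rcases mul_eq_zero.mp hkey with h | h
  · exfalso
    apply hcon
    rw [sub_eq_zero, div_eq_one_iff_eq hw0] at h
    exact h
  · exact h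

/-- A polynomial has a root close to any point where it is small. -/
lemma exists_root_near (p : ℂ[X]) (hp : 0 < p.natDegree) (t : ℂ) :
    ∃ z, p.eval z = 0 ∧ ‖p.leadingCoeff‖ * ‖t - z‖ ^ p.natDegree ≤ ‖p.eval t‖ := by
  have hp0 : p ≠ 0 := by
    rintro rfl
    simp at hp
  have hs := IsAlgClosed.splits p
  have hcard : p.roots.card = p.natDegree := splits_iff_card_roots.mp hs
  have hev : p.eval t = p.leadingCoeff * (p.roots.map (fun a => t - a)).prod :=
    hs.eval_eq_prod_roots t
  by_contra hcon
  push Not at hcon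
  have hlc : 0 < ‖p.leadingCoeff‖ := norm_pos_iff.mpr (leadingCoeff_ne_zero.mpr hp0)
  obtain ⟨z, hz, hmin⟩ : ∃ z ∈ p.roots.toFinset, ∀ z' ∈ p.roots.toFinset, ‖t - z‖ ≤ ‖t - z'‖ := by
    apply Finset.exists_min_image
    obtain ⟨a, ha⟩ := Multiset.card_pos_iff_exists_mem.mp (hcard ▸ hp)
    exact ⟨a, Multiset.mem_toFinset.mpr ha⟩
  have hz' : p.eval z = 0 := (mem_roots hp0).mp (Multiset.mem_toFinset.mp hz)
  have h1 := hcon z hz'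
  rw [hev, norm_mul] at h1
  have h2 : ‖t - z‖ ^ p.natDegree ≤ ‖(p.roots.map (fun a => t - a)).prod‖ := by
    have h3 : ‖(p.roots.map (fun a => t - a)).prod‖ = (p.roots.map (fun a => ‖t - a‖)).prod := by
      have := map_multiset_prod (normHom : ℂ →*₀ ℝ) (p.roots.map (fun a => t - a))
      simpa [Multiset.map_map] using this
    rw [h3, ← hcard]
    have h4 : ∀ m : Multiset ℂ, (∀ a ∈ m, ‖t - z‖ ≤ ‖t - a‖) →
        ‖t - z‖ ^ m.card ≤ (m.map (fun a => ‖t - a‖)).prod := by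
      intro m
      induction m using Multiset.induction with
      | empty => simp
      | cons a m ih =>
        intro h
        rw [Multiset.card_cons, pow_succ', Multiset.map_cons, Multiset.prod_cons]
        exact mul_le_mul (h a (Multiset.mem_cons_self a m))
          (ih fun b hb => h b (Multiset.mem_cons_of_mem hb)) (by positivity) (norm_nonneg _)
    exact h4 _ fun a ha => hmin a (Multiset.mem_toFinset.mpr ha)
  have := mul_le_mul_of_nonneg_left h2 hlc.le
  linarith

lemma exists_common_root (a b : ℕ) (hab : Nat.Coprime a b) (x y : ℂ) (hx : x ≠ 0) (hy : y ≠ 0)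
    (h : x ^ b = y ^ a) : ∃ s : ℂ, s ^ a = x ∧ s ^ b = y := by
  have hbz := Nat.gcd_eq_gcd_ab a b
  rw [hab] at hbz
  set i := Nat.gcdA a b
  set j := Nat.gcdB a b
  have h' : x ^ (b : ℤ) = y ^ (a : ℤ) := by exact_mod_cast h
  refine ⟨x ^ i * y ^ j, ?_, ?_⟩
  · rw [← zpow_natCast, mul_zpow, ← zpow_mul, ← zpow_mul, mul_comm j, zpow_mul y, ← h', ← zpow_mul,
      ← zpow_add₀ hx, mul_comm i, ← hbz]
    simp
  · rw [← zpow_natCast, mul_zpow, ← zpow_mul, ← zpow_mul, mul_comm i, zpow_mul x, h', ← zpow_mul,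
      ← zpow_add₀ hy, mul_comm j, ← hbz]
    simp

end Stmt15

namespace Stmt15

lemma glue_seq (A B F G P Q : ℂ[X]) (κ a b s M : ℕ) (hM : 0 < M) (hκ : 0 < κ) (ha : 0 < a) (hb : 0 < b)
    (hab : Nat.Coprime a b)
    (hA : A.natDegree = κ * a) (hB : B.natDegree = κ * b)
    (hF : F.natDegree * b = P.natDegree * s) (hG : G.natDegree * a = Q.natDegree * s)
    (hF0 : 0 < F.natDegree) (hG0 : 0 < G.natDegree) (hP0 : 0 < P.natDegree)
    (hlc : (F.leadingCoeff / A.leadingCoeff) ^ b * (Q.leadingCoeff / P.leadingCoeff) ^ s =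
      (G.leadingCoeff / B.leadingCoeff) ^ a)
    (H3 : ∀ x y z, P.eval x = Q.eval y → A.eval z = F.eval x →
      A.eval (B.eval z) ^ M = A.eval (G.eval y) ^ M)
    (x y : ℕ → ℂ) (hx : Tendsto (fun k => ‖x k‖) atTop atTop)
    (hxy : ∀ k, P.eval (x k) = Q.eval (y k)) :
    ∀ᶠ k in atTop, ∃ z, A.eval z = F.eval (x k) ∧ B.eval z = G.eval (y k) := by
  have hA0 : 0 < A.natDegree := hA ▸ Nat.mul_pos hκ ha
  have hB0 : 0 < B.natDegree := hB ▸ Nat.mul_pos hκ hb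
  have lcne : ∀ p : ℂ[X], 0 < p.natDegree → p.leadingCoeff ≠ 0 := by
    intro p hp h
    rw [leadingCoeff_eq_zero] at h
    simp [h] at hp
  have hlA := lcne A hA0
  have hlB := lcne B hB0
  have hlF := lcne F hF0
  have hlG := lcne G hG0
  have hlP := lcne P hP0
  have hPx := tendsto_eval_atTop P hP0 x hx
  have hy : Tendsto (fun k => ‖y k‖) atTop atTop := by
    apply tendsto_of_eval_atTop Q
    simpa only [← hxy] using hPx
  have hFx := tendsto_eval_atTop F hF0 x hx
  have hGy := tendsto_eval_atTop G hG0 y hy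
  have nz : ∀ u : ℕ → ℂ, Tendsto (fun k => ‖u k‖) atTop atTop → ∀ᶠ k in atTop, u k ≠ 0 := by
    intro u hu
    filter_upwards [hu.eventually_gt_atTop 0] with k hk
    exact norm_pos_iff.mp hk
  set X : ℕ → ℂ := fun k => F.eval (x k) / A.leadingCoeff with hXdef
  set Y : ℕ → ℂ := fun k => G.eval (y k) / B.leadingCoeff with hYdef
  have hX0 : ∀ᶠ k in atTop, X k ≠ 0 := by
    filter_upwards [nz _ hFx] with k hk
    exact div_ne_zero hk hlA
  have hY0 : ∀ᶠ k in atTop, Y k ≠ 0 := by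
    filter_upwards [nz _ hGy] with k hk
    exact div_ne_zero hk hlB
  set ε : ℕ → ℂ := fun k => X k ^ b / Y k ^ a with hεdef
  have hε : Tendsto ε atTop (𝓝 1) := by
    have h1 := tendsto_div_pow P x hx
    have h2 := tendsto_div_pow Q y hy
    have h3 := tendsto_div_pow F x hx
    have h4 := tendsto_div_pow G y hy
    have h5 := (((h3.div_const A.leadingCoeff).pow b).mul ((h2.div h1 hlP).pow s)).div
      ((h4.div_const B.leadingCoeff).pow a) (pow_ne_zero _ (div_ne_zero hlG hlB))
    rw [hlc, div_self (pow_ne_zero _ (div_ne_zero hlG hlB))] at h5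
    refine h5.congr' ?_
    filter_upwards [nz _ hx, nz _ hy, nz _ hPx, nz _ hGy] with k hxk hyk hPk hGk
    have e1 : (x k ^ F.natDegree) ^ b = (x k ^ P.natDegree) ^ s := by
      rw [← pow_mul, ← pow_mul, hF]
    have e2 : (y k ^ G.natDegree) ^ a = (y k ^ Q.natDegree) ^ s := by
      rw [← pow_mul, ← pow_mul, hG]
    simp only [hεdef, hXdef, hYdef, ← hxy, Pi.div_apply]
    have e3 : P.eval (x k) / y k ^ Q.natDegree / (P.eval (x k) / x k ^ P.natDegree) =
        x k ^ P.natDegree / y k ^ Q.natDegree := by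
      field_simp
    rw [e3]
    simp only [div_pow]
    rw [e1, e2]
    have n1 := pow_ne_zero s (pow_ne_zero P.natDegree hxk)
    have n2 := pow_ne_zero s (pow_ne_zero Q.natDegree hyk)
    have n3 := pow_ne_zero b hlA
    have n4 := pow_ne_zero a hlB
    have n5 := pow_ne_zero a hGk
    generalize (x k ^ P.natDegree) ^ s = t1 at *
    generalize (y k ^ Q.natDegree) ^ s = t2 at *
    generalize A.leadingCoeff ^ b = t3 at *
    generalize B.leadingCoeff ^ a = t4 at *
    generalize (eval (y k) G) ^ a = t5 at *
    field_simp
  set η : ℕ → ℂ := fun k => ε k ^ ((a : ℂ)⁻¹) with hηdef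
  have hη : Tendsto η atTop (𝓝 1) := by
    have hc : ContinuousAt (fun z : ℂ => z ^ ((a : ℂ)⁻¹)) 1 :=
      continuousAt_cpow_const (by simp)
    have := hc.tendsto.comp hε
    rw [Complex.one_cpow] at this
    exact this
  have hηa : ∀ k, η k ^ a = ε k := fun k => Complex.cpow_nat_inv_pow _ ha.ne'
  have hη0 : ∀ᶠ k in atTop, η k ≠ 0 := hη.eventually_ne one_ne_zero
  have hex : ∀ k, ∃ t : ℂ, X k ≠ 0 → Y k ≠ 0 → η k ≠ 0 →
      t ^ (κ * a) = X k ∧ t ^ (κ * b) = Y k * η k := by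
    intro k
    by_cases h : X k ≠ 0 ∧ Y k ≠ 0 ∧ η k ≠ 0
    · obtain ⟨h1, h2, h3⟩ := h
      obtain ⟨u, hu1, hu2⟩ := exists_common_root a b hab (X k) (Y k * η k) h1 (mul_ne_zero h2 h3)
        (by
          rw [mul_pow, hηa]
          simp only [hεdef]
          field_simp)
      obtain ⟨t, ht⟩ := IsAlgClosed.exists_pow_nat_eq u hκ
      exact ⟨t, fun _ _ _ => ⟨by rw [pow_mul, ht, hu1], by rw [pow_mul, ht, hu2]⟩⟩
    · exact ⟨0, fun h1 h2 h3 => absurd ⟨h1, h2, h3⟩ h⟩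
  choose t ht using hex
  have hnear : ∀ k, ∃ z, A.eval z = F.eval (x k) ∧
      ‖A.leadingCoeff‖ * ‖t k - z‖ ^ A.natDegree ≤ ‖A.eval (t k) - F.eval (x k)‖ := by
    intro k
    obtain ⟨z, hz1, hz2⟩ := exists_root_near (A - C (F.eval (x k)))
      (by rwa [natDegree_sub_C]) (t k)
    refine ⟨z, by simpa [sub_eq_zero] using hz1, ?_⟩
    rw [natDegree_sub_C] at hz2
    have : (A - C (F.eval (x k))).leadingCoeff = A.leadingCoeff := by
      rw [leadingCoeff, leadingCoeff, natDegree_sub_C, coeff_sub, coeff_C_of_ne_zero hA0.ne', sub_zero]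
    rw [this] at hz2
    simpa using hz2
  choose z hz1 hz2 using hnear
  have hev : ∀ᶠ k in atTop, t k ^ (κ * a) = X k ∧ t k ^ (κ * b) = Y k * η k := by
    filter_upwards [hX0, hY0, hη0] with k h1 h2 h3
    exact ht k h1 h2 h3
  have htinf : Tendsto (fun k => ‖t k‖) atTop atTop := by
    apply tendsto_of_eval_atTop (C A.leadingCoeff * Polynomial.X ^ (κ * a))
    refine hFx.congr' ?_
    filter_upwards [hev] with k hk
    rw [eval_mul, eval_C, eval_pow, eval_X, hk.1]
    simp only [hXdef]
    rw [mul_div_cancel₀ _ hlA]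
  have hzt : Tendsto (fun k => z k / t k) atTop (𝓝 1) := by
    have h1 := tendsto_div_pow A t htinf
    have h2 : Tendsto (fun k => ‖A.eval (t k) / t k ^ A.natDegree - A.leadingCoeff‖ /
        ‖A.leadingCoeff‖) atTop (𝓝 0) := by
      have := ((h1.sub_const A.leadingCoeff).norm).div_const ‖A.leadingCoeff‖
      simpa using this
    have h3 : Tendsto (fun k => ‖1 - z k / t k‖ ^ A.natDegree) atTop (𝓝 0) := by
      refine tendsto_of_tendsto_of_tendsto_of_le_of_le' tendsto_const_nhds h2
        (Eventually.of_forall fun k => by positivity) ?_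
      filter_upwards [hev, nz _ htinf] with k hk htk
      have hnA : 0 < ‖A.leadingCoeff‖ := norm_pos_iff.mpr hlA
      rw [le_div_iff₀ hnA]
      have e1 : F.eval (x k) = A.leadingCoeff * t k ^ A.natDegree := by
        rw [hA, hk.1]
        simp only [hXdef]
        rw [mul_div_cancel₀ _ hlA]
      have e2 : A.eval (t k) / t k ^ A.natDegree - A.leadingCoeff =
          (A.eval (t k) - F.eval (x k)) / t k ^ A.natDegree := by
        rw [e1]
        field_simp
      have e3 : 1 - z k / t k = (t k - z k) / t k := by field_simp
      rw [e2, e3, norm_div, norm_div, div_pow, norm_pow, div_mul_eq_mul_div]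
      have : 0 < ‖t k‖ := norm_pos_iff.mpr htk
      gcongr
      rw [mul_comm]
      exact hz2 k
    have h4 : Tendsto (fun k => ‖1 - z k / t k‖) atTop (𝓝 0) := by
      have := h3.rpow_const (p := ((A.natDegree : ℝ)⁻¹)) (Or.inr (by positivity))
      rw [Real.zero_rpow (by positivity)] at this
      refine this.congr fun k => ?_
      exact Real.pow_rpow_inv_natCast (norm_nonneg _) hA0.ne'
    have h5 := tendsto_zero_iff_norm_tendsto_zero.mpr h4
    have h6 := (tendsto_const_nhds (x := (1 : ℂ))).sub h5
    simpa using h6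
  have hzinf : Tendsto (fun k => ‖z k‖) atTop atTop := by
    apply tendsto_of_eval_atTop A
    simpa only [hz1] using hFx
  have hBG : Tendsto (fun k => B.eval (z k) / G.eval (y k)) atTop (𝓝 1) := by
    have h1 := tendsto_div_pow B z hzinf
    have h2 := ((h1.mul (hzt.pow B.natDegree)).mul hη).div_const B.leadingCoeff
    have : B.leadingCoeff * 1 ^ B.natDegree * 1 / B.leadingCoeff = 1 := by
      field_simp
      simp
    rw [this] at h2
    refine h2.congr' ?_
    filter_upwards [hev, nz _ htinf, nz _ hzinf, nz _ hGy, hη0] with k hk htk hzk hGk hηk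
    have e1 : G.eval (y k) = B.leadingCoeff * t k ^ B.natDegree / η k := by
      rw [hB, hk.2]
      simp only [hYdef]
      field_simp
    rw [e1, div_pow]
    have n1 := pow_ne_zero B.natDegree htk
    have n2 := pow_ne_zero B.natDegree hzk
    generalize t k ^ B.natDegree = t1 at *
    generalize z k ^ B.natDegree = t2 at *
    field_simp
  have := eventually_eq_of_ratio (A ^ M) (by rw [natDegree_pow]; positivity)
    (fun k => B.eval (z k)) (fun k => G.eval (y k)) hGy hBG
    (Eventually.of_forall fun k => by
      simpa using H3 (x k) (y k) (z k) (hxy k) (hz1 k))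
  filter_upwards [this] with k hk
  exact ⟨z k, hz1 k, hk⟩

end Stmt15

namespace Stmt15

/-- Every nonconstant complex polynomial is surjective. -/
lemma eval_surj (p : ℂ[X]) (hp : 0 < p.natDegree) (w : ℂ) : ∃ z, p.eval z = w := by
  obtain ⟨z, hz, -⟩ := exists_root_near (p - C w) (by rwa [natDegree_sub_C]) 0
  exact ⟨z, by simpa [sub_eq_zero] using hz⟩

lemma glue_ext (A B F G P Q : ℂ[X]) (hA0 : 0 < A.natDegree)
    (hP0 : 0 < P.natDegree) (hQ0 : 0 < Q.natDegree)
    (hseq : ∀ x y : ℕ → ℂ, Tendsto (fun k => ‖x k‖) atTop atTop →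
      (∀ k, P.eval (x k) = Q.eval (y k)) →
      ∀ᶠ k in atTop, ∃ z, A.eval z = F.eval (x k) ∧ B.eval z = G.eval (y k))
    (x y : ℂ) (hxy : P.eval x = Q.eval y) :
    ∃ z, A.eval z = F.eval x ∧ B.eval z = G.eval y := by
  classical
  have hQne : Q ≠ 0 := by rintro rfl; simp at hQ0
  have hlQ : Q.leadingCoeff ≠ 0 := leadingCoeff_ne_zero.mpr hQne
  -- the resultant
  let A1 : (ℂ[X][X])[X] := A.map ((C : ℂ[X] →+* ℂ[X][X]).comp C) - C (C F)
  let B1 : (ℂ[X][X])[X] := B.map ((C : ℂ[X] →+* ℂ[X][X]).comp C) - C (G.map C)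
  let Rp : ℂ[X][X] := resultant A1 B1 A.natDegree B.natDegree
  have hev : ∀ x y : ℂ, evalEvalRingHom x y Rp =
      resultant (A - C (F.eval x)) (B - C (G.eval y)) := by
    intro x y
    simp only [Rp]
    rw [← resultant_map_map, natDegree_sub_C, natDegree_sub_C]
    have hcc : (evalEvalRingHom x y).comp ((C : ℂ[X] →+* ℂ[X][X]).comp C) = RingHom.id ℂ := by
      ext z; simp
    congr 1
    · simp only [A1, Polynomial.map_sub, Polynomial.map_map, hcc, Polynomial.map_id, map_C]
      simp
    · simp only [B1, Polynomial.map_sub, Polynomial.map_map, hcc, Polynomial.map_id, map_C]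
      congr 2
      simp
  have hiff : ∀ x y : ℂ, evalEvalRingHom x y Rp = 0 ↔
      ∃ z, A.eval z = F.eval x ∧ B.eval z = G.eval y := by
    intro x y
    rw [hev, resultant_eq_zero_iff]
    have hne : A - C (F.eval x) ≠ 0 := by
      intro h
      have := natDegree_sub_C (p := A) (a := F.eval x)
      rw [h] at this
      simp at this
      omega
    have hcop : ¬ IsCoprime (A - C (F.eval x)) (B - C (G.eval y)) ↔
        ∃ z, A.eval z = F.eval x ∧ B.eval z = G.eval y := by
      constructor
      · intro h
        have hg : ¬ IsUnit (EuclideanDomain.gcd (A - C (F.eval x)) (B - C (G.eval y))) := by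
          rwa [EuclideanDomain.gcd_isUnit_iff]
        have hg0 : EuclideanDomain.gcd (A - C (F.eval x)) (B - C (G.eval y)) ≠ 0 := by
          intro h0
          exact hne (EuclideanDomain.gcd_eq_zero_iff.mp h0).1
        obtain ⟨z, hz⟩ := IsAlgClosed.exists_root _
          (fun hd => hg (isUnit_iff_degree_eq_zero.mpr hd))
        have h1 := hz.dvd (EuclideanDomain.gcd_dvd_left (A - C (F.eval x)) (B - C (G.eval y)))
        have h2 := hz.dvd (EuclideanDomain.gcd_dvd_right (A - C (F.eval x)) (B - C (G.eval y)))
        refine ⟨z, ?_, ?_⟩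
        · simpa [sub_eq_zero] using h1
        · simpa [sub_eq_zero] using h2
      · rintro ⟨z, h1, h2⟩ ⟨u, v, huv⟩
        have := congrArg (eval z) huv
        simp [h1, h2] at this
    rw [hcop]
    exact ⟨fun h => h.2, fun h => ⟨Or.inl hne, h⟩⟩
  rw [← hiff]
  -- the monic divisor
  let Qm : ℂ[X][X] := C (C Q.leadingCoeff⁻¹) * (Q.map C - C P)
  have hQmap : (Q.map (C : ℂ →+* ℂ[X])).natDegree = Q.natDegree :=
    natDegree_map_eq_of_injective C_injective Q
  have hdeg1 : (Q.map (C : ℂ →+* ℂ[X]) - C P).natDegree = Q.natDegree := by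
    rw [natDegree_sub_C, hQmap]
  have hQmdeg : Qm.natDegree = Q.natDegree := by
    simp only [Qm]
    rw [natDegree_C_mul, hdeg1]
    simpa using hlQ
  have hQm : Qm.Monic := by
    rw [Monic, leadingCoeff, hQmdeg]
    simp only [Qm]
    rw [coeff_C_mul, coeff_sub, coeff_C_of_ne_zero hQ0.ne', sub_zero, coeff_map, ← C_mul]
    rw [coeff_natDegree, inv_mul_cancel₀ hlQ, C_1]
  have hQme : ∀ x y : ℂ, P.eval x = Q.eval y → evalEvalRingHom x y Qm = 0 := by
    intro x y h
    simp [Qm, h]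
  have hdiv := modByMonic_add_div Rp Qm
  set r := Rp %ₘ Qm with hr
  have hrdeg : r.natDegree < Q.natDegree := by
    rw [← hQmdeg]
    exact natDegree_modByMonic_lt Rp hQm (by
      intro h
      rw [h] at hQmdeg
      simp at hQmdeg
      omega)
  have hrR : ∀ x y : ℂ, P.eval x = Q.eval y → evalEvalRingHom x y Rp = evalEvalRingHom x y r := by
    intro x y h
    conv_lhs => rw [← hdiv]
    rw [map_add, map_mul, hQme x y h, zero_mul, add_zero]
  suffices hr0 : r = 0 by
    rw [hrR x y hxy, hr0, map_zero]
  -- for large integers k the remainder vanishes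
  have hnat : Tendsto (fun k : ℕ => ‖(k : ℂ)‖) atTop atTop := by
    simpa using tendsto_natCast_atTop_atTop (R := ℝ)
  have hlarge : ∀ᶠ k : ℕ in atTop, ∀ y, P.eval (k : ℂ) = Q.eval y →
      ∃ z, A.eval z = F.eval (k : ℂ) ∧ B.eval z = G.eval y := by
    have hex : ∀ k : ℕ, ∃ y, P.eval (k : ℂ) = Q.eval y ∧
        ((∃ z, A.eval z = F.eval (k : ℂ) ∧ B.eval z = G.eval y) →
        ∀ y, P.eval (k : ℂ) = Q.eval y →
          ∃ z, A.eval z = F.eval (k : ℂ) ∧ B.eval z = G.eval y) := by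
      intro k
      by_cases h : ∀ y, P.eval (k : ℂ) = Q.eval y →
          ∃ z, A.eval z = F.eval (k : ℂ) ∧ B.eval z = G.eval y
      · obtain ⟨y, hy⟩ := eval_surj Q hQ0 (P.eval (k : ℂ))
        exact ⟨y, hy.symm, fun _ => h⟩
      · push Not at h
        obtain ⟨y, hy, hy'⟩ := h
        exact ⟨y, hy, fun ⟨z, h1, h2⟩ => absurd h2 (hy' z h1)⟩
    choose y hy1 hy2 using hex
    filter_upwards [hseq (fun k => (k : ℂ)) y hnat hy1] with k hk
    exact hy2 k hk
  have hsep : ∀ᶠ k : ℕ in atTop, ∀ y, P.eval (k : ℂ) = Q.eval y → Q.derivative.eval y ≠ 0 := by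
    have hfin : ((fun y => Q.eval y) '' {y | Q.derivative.eval y = 0}).Finite := by
      apply Set.Finite.image
      have hne : Q.derivative ≠ 0 := by
        intro h
        have := derivative_eq_zero.mp h
        omega
      exact (Q.derivative.roots.toFinset.finite_toSet).subset (by
        intro y hy
        simpa [hne] using hy)
    obtain ⟨c, hc⟩ := hfin.isBounded.exists_norm_le
    filter_upwards [(tendsto_eval_atTop P hP0 _ hnat).eventually_gt_atTop c] with k hk y hy h0
    have := hc _ ⟨y, h0, rfl⟩
    simp only [← hy] at this
    linarith
  have hmap : ∀ᶠ k : ℕ in atTop, r.map (evalRingHom (k : ℂ)) = 0 := by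
    filter_upwards [hlarge, hsep] with k h1 h2
    set q := Q - C (P.eval (k : ℂ)) with hq
    have hqd : q.natDegree = Q.natDegree := natDegree_sub_C
    have hq0 : q ≠ 0 := by
      intro h
      rw [h] at hqd
      simp at hqd
      omega
    have hqs : q.roots.Nodup := by
      rw [Multiset.nodup_iff_count_le_one]
      intro y
      rw [count_roots]
      by_contra hcon
      have hgt : 1 < q.rootMultiplicity y := by omega
      rw [one_lt_rootMultiplicity_iff_isRoot hq0] at hgt
      have e1 : Q.eval y = P.eval (k : ℂ) := by
        have := hgt.1
        simpa [hq, sub_eq_zero] using this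
      have e2 := hgt.2
      simp only [hq, derivative_sub, derivative_C, sub_zero] at e2
      exact h2 y e1.symm e2
    have hcard : q.roots.toFinset.card = Q.natDegree := by
      rw [Multiset.toFinset_card_of_nodup hqs, splits_iff_card_roots.mp (IsAlgClosed.splits q), hqd]
    refine eq_zero_of_natDegree_lt_card_of_eval_eq_zero' _ q.roots.toFinset ?_ ?_
    · intro y hy
      have e1 : P.eval (k : ℂ) = Q.eval y := by
        have := (mem_roots hq0).mp (Multiset.mem_toFinset.mp hy)
        simp only [hq, IsRoot.def, eval_sub, eval_C, sub_eq_zero] at this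
        exact this.symm
      rw [map_evalRingHom_eval, ← coe_evalEvalRingHom, ← hrR _ _ e1, hiff]
      exact h1 y e1
    · rw [hcard]
      exact lt_of_le_of_lt (natDegree_map_le) hrdeg
  obtain ⟨k0, hk0⟩ := eventually_atTop.mp hmap
  ext1 i
  rw [coeff_zero]
  apply eq_zero_of_infinite_isRoot
  refine Set.Infinite.mono (s := (fun k : ℕ => (k : ℂ)) '' Set.Ici k0) ?_ ?_
  · rintro _ ⟨k, hk, rfl⟩
    have := congrArg (fun p => p.coeff i) (hk0 k hk)
    simpa [coeff_map] using this
  · exact (Set.Ici_infinite k0).image (Nat.cast_injective.injOn)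

end Stmt15

namespace Stmt15

/-- The geometric sum `1 + x + ... + x^(n-1)`. -/
def gs (x n : ℕ) : ℕ := ∑ i ∈ Finset.range n, x ^ i

lemma gs_zero (x : ℕ) : gs x 0 = 0 := by simp [gs]

lemma gs_succ (x n : ℕ) : gs x (n + 1) = x * gs x n + 1 := by
  simp only [gs]
  exact geom_sum_succ

/-- The polynomial iterate. -/
noncomputable def it (f : ℂ[X]) (n : ℕ) : ℂ[X] := f.comp^[n] X

lemma it_eval (f : ℂ[X]) (n : ℕ) (z : ℂ) : (it f n).eval z = (fun y => f.eval y)^[n] z := by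
  rw [it, iterate_comp_eval, eval_X]

lemma it_natDegree (f : ℂ[X]) (n : ℕ) : (it f n).natDegree = f.natDegree ^ n := by
  rw [it, natDegree_iterate_comp, natDegree_X, mul_one]

lemma it_add (f : ℂ[X]) (n m : ℕ) : it f (n + m) = (it f n).comp (it f m) := by
  apply Polynomial.funext
  intro z
  rw [eval_comp, it_eval, it_eval, it_eval, Function.iterate_add_apply]

/-- The algebraic setting produced by the analytic part of the proof. -/
structure Setting (f g : ℂ[X]) (γ : ℂ) (M : ℕ) : Prop where
  hM : 0 < M
  hγ : γ ^ M = 1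
  hf : 0 < f.natDegree
  hg : 0 < g.natDegree
  comm : ∀ z, f.eval (g.eval z) = γ * g.eval (f.eval z)
  rotf : ∀ z, f.eval (γ * z) = γ ^ f.natDegree * f.eval z
  rotg : ∀ z, g.eval (γ * z) = γ ^ g.natDegree * g.eval z

section
variable {f g : ℂ[X]} {γ : ℂ} {M : ℕ}

lemma rot_pow (p : ℂ[X]) (d : ℕ) (h : ∀ z, p.eval (γ * z) = γ ^ d * p.eval z) (i : ℕ) (z : ℂ) :
    p.eval (γ ^ i * z) = γ ^ (i * d) * p.eval z := by
  induction i generalizing z with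
  | zero => simp
  | succ i ih =>
    rw [pow_succ, mul_assoc, ih, h, ← mul_assoc, ← pow_add]
    congr 2
    ring

lemma rot_it (p : ℂ[X]) (h : ∀ z, p.eval (γ * z) = γ ^ p.natDegree * p.eval z) (n i : ℕ) (z : ℂ) :
    (it p n).eval (γ ^ i * z) = γ ^ (i * p.natDegree ^ n) * (it p n).eval z := by
  induction n generalizing z i with
  | zero => simp [it]
  | succ n ih =>
    rw [it_eval, it_eval, Function.iterate_succ_apply, Function.iterate_succ_apply, ← it_eval,
      ← it_eval, rot_pow p _ h, ih]
    congr 2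
    ring

lemma Setting.comm_it (S : Setting f g γ M) (m n : ℕ) (z : ℂ) :
    (it f m).eval ((it g n).eval z) =
      γ ^ (gs f.natDegree m * gs g.natDegree n) * (it g n).eval ((it f m).eval z) := by
  have h1 : ∀ n z, f.eval ((it g n).eval z) =
      γ ^ (gs g.natDegree n) * (it g n).eval (f.eval z) := by
    intro n
    induction n with
    | zero => intro z; simp [it, gs]
    | succ n ih =>
      intro z
      rw [it_eval, it_eval, Function.iterate_succ_apply', Function.iterate_succ_apply', S.comm,
        ← it_eval, ih, rot_pow g _ S.rotg, ← it_eval, gs_succ]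
      ring
  induction m with
  | zero => simp [it, gs]
  | succ m ih =>
    rw [it_eval, it_eval f, Function.iterate_succ_apply', Function.iterate_succ_apply',
      ← it_eval, ← it_eval, ih, rot_pow f _ S.rotf, h1, gs_succ]
    ring

/-- Equality up to a power of `γ`. -/
def Rel (γ : ℂ) (u v : ℂ) : Prop := ∃ i : ℕ, u = γ ^ i * v

lemma Rel.trans {u v w : ℂ} (h1 : Rel γ u v) (h2 : Rel γ v w) : Rel γ u w := by
  obtain ⟨i, rfl⟩ := h1
  obtain ⟨j, rfl⟩ := h2
  exact ⟨i + j, by rw [pow_add, mul_assoc]⟩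

lemma Setting.symm (S : Setting f g γ M) {u v : ℂ} (h1 : Rel γ u v) : Rel γ v u := by
  obtain ⟨i, rfl⟩ := h1
  obtain ⟨N, hN⟩ : ∃ N, M = N + 1 := ⟨M - 1, by have := S.hM; omega⟩
  refine ⟨N * i, ?_⟩
  rw [← mul_assoc, ← pow_add]
  have : N * i + i = M * i := by rw [hN]; ring
  rw [this, pow_mul, S.hγ]
  simp

lemma Rel.map {u v : ℂ} (p : ℂ[X]) (h : ∀ z, p.eval (γ * z) = γ ^ p.natDegree * p.eval z) (n : ℕ)
    (h1 : Rel γ u v) : Rel γ ((it p n).eval u) ((it p n).eval v) := by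
  obtain ⟨i, rfl⟩ := h1
  exact ⟨_, rot_it p h n i v⟩

lemma Rel.pow_eq {u v : ℂ} (hγ : γ ^ M = 1) (h1 : Rel γ u v) : u ^ M = v ^ M := by
  obtain ⟨i, rfl⟩ := h1
  rw [mul_pow, ← pow_mul, mul_comm i, pow_mul, hγ]
  simp

lemma lc_ne {p : ℂ[X]} (hp : 0 < p.natDegree) : p.leadingCoeff ≠ 0 := by
  intro h
  rw [leadingCoeff_eq_zero] at h
  simp [h] at hp

lemma it_deg_pos {p : ℂ[X]} (hp : 0 < p.natDegree) (n : ℕ) : 0 < (it p n).natDegree := by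
  rw [it_natDegree]
  positivity

lemma it_lc_add {p : ℂ[X]} (hp : 0 < p.natDegree) (n m : ℕ) : (it p (n + m)).leadingCoeff =
    (it p n).leadingCoeff * (it p m).leadingCoeff ^ (p.natDegree ^ n) := by
  rw [it_add, leadingCoeff_comp (it_deg_pos hp m).ne', it_natDegree]

/-- The gluing lemma. -/
lemma Setting.glue (S : Setting f g γ M) (q a b : ℕ) (hd : f.natDegree = q * a)
    (he : g.natDegree = q * b) (hab : Nat.Coprime a b) (n m i j t : ℕ)
    (hcond : γ ^ (i * b ^ (n + m) + (t + gs f.natDegree m * gs g.natDegree n) * (a ^ n * b ^ m)) =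
      γ ^ (j * a ^ (n + m)))
    (x y : ℂ) (hxy : (it g n).eval x = γ ^ t * (it f m).eval y) :
    ∃ z, (it f (n + m)).eval z = γ ^ i * (it f n).eval x ∧
      (it g (n + m)).eval z = γ ^ j * (it g m).eval y := by
  have hd0 := S.hf
  have he0 := S.hg
  rw [hd] at hd0
  rw [he] at he0
  have hq0 : 0 < q := Nat.pos_of_mul_pos_right hd0
  have ha0 : 0 < a := Nat.pos_of_mul_pos_left hd0
  have hb0 : 0 < b := Nat.pos_of_mul_pos_left he0
  have hγ0 : γ ≠ 0 := by
    rintro rfl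
    have := S.hγ
    rw [zero_pow S.hM.ne'] at this
    exact zero_ne_one this
  have hgp : ∀ k, γ ^ k ≠ 0 := fun k => pow_ne_zero k hγ0
  set A := it f (n + m) with hA
  set B := it g (n + m) with hB
  set F := C (γ ^ i) * it f n with hF
  set G := C (γ ^ j) * it g m with hG
  set P := it g n with hP
  set Q := C (γ ^ t) * it f m with hQ
  have dF : F.natDegree = f.natDegree ^ n := by
    rw [hF, natDegree_C_mul (hgp _), it_natDegree]
  have dG : G.natDegree = g.natDegree ^ m := by
    rw [hG, natDegree_C_mul (hgp _), it_natDegree]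
  have dQ : Q.natDegree = f.natDegree ^ m := by
    rw [hQ, natDegree_C_mul (hgp _), it_natDegree]
  have dP : P.natDegree = g.natDegree ^ n := it_natDegree _ _
  have hfp := S.hf
  have hgp' := S.hg
  have hF0 : 0 < F.natDegree := by rw [dF]; positivity
  have hG0 : 0 < G.natDegree := by rw [dG]; positivity
  have hP0 : 0 < P.natDegree := by rw [dP]; positivity
  have hQ0 : 0 < Q.natDegree := by rw [dQ]; positivity
  have hrel : (it f m).leadingCoeff * (it g n).leadingCoeff ^ (f.natDegree ^ m) =
      γ ^ (gs f.natDegree m * gs g.natDegree n) *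
        ((it g n).leadingCoeff * (it f m).leadingCoeff ^ (g.natDegree ^ n)) := by
    have : (it f m).comp (it g n) =
        C (γ ^ (gs f.natDegree m * gs g.natDegree n)) * (it g n).comp (it f m) := by
      apply Polynomial.funext
      intro z
      rw [eval_mul, eval_C, eval_comp, eval_comp, S.comm_it]
    have := congrArg leadingCoeff this
    rw [leadingCoeff_mul, leadingCoeff_C, leadingCoeff_comp (it_deg_pos S.hg n).ne',
      leadingCoeff_comp (it_deg_pos S.hf m).ne', it_natDegree, it_natDegree] at this
    exact this
  have key := glue_ext A B F G P Q (it_deg_pos S.hf _) hP0 hQ0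
    (glue_seq A B F G P Q (q ^ (n + m)) (a ^ (n + m)) (b ^ (n + m)) (a ^ n * b ^ m) M S.hM
      (by positivity) (by positivity) (by positivity) (Nat.Coprime.pow _ _ hab)
      (by rw [hA, it_natDegree, hd, mul_pow]) (by rw [hB, it_natDegree, he, mul_pow])
      (by rw [dF, dP, hd, he, mul_pow, mul_pow, pow_add]; ring)
      (by rw [dG, dQ, hd, he, mul_pow, mul_pow, pow_add]; ring) hF0 hG0 hP0 ?_ ?_) x y
      (by rw [hxy, hQ, eval_mul, eval_C])
  · obtain ⟨z, h1, h2⟩ := key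
    refine ⟨z, ?_, ?_⟩
    · rw [h1, hF, eval_mul, eval_C]
    · rw [h2, hG, eval_mul, eval_C]
  · -- leading coefficients
    rw [hF, hG, hQ, leadingCoeff_mul, leadingCoeff_mul, leadingCoeff_mul, leadingCoeff_C,
      leadingCoeff_C, leadingCoeff_C, hA, it_lc_add S.hf, hB, add_comm n m, it_lc_add S.hg, hP]
    have hu1 := lc_ne (it_deg_pos S.hf n)
    have hu := lc_ne (it_deg_pos S.hf m)
    have hv1 := lc_ne (it_deg_pos S.hg m)
    have hv := lc_ne (it_deg_pos S.hg n)
    generalize (it f n).leadingCoeff = u1 at *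
    generalize (it f m).leadingCoeff = u at *
    generalize (it g m).leadingCoeff = v1 at *
    generalize (it g n).leadingCoeff = v at *
    have r1 : γ ^ i * u1 / (u1 * u ^ f.natDegree ^ n) = γ ^ i / u ^ f.natDegree ^ n := by
      field_simp
    have r2 : γ ^ j * v1 / (v1 * v ^ g.natDegree ^ m) = γ ^ j / v ^ g.natDegree ^ m := by
      field_simp
    rw [r1, r2, div_pow, div_pow, div_pow, mul_pow, ← pow_mul, ← pow_mul, ← pow_mul, ← pow_mul,
      ← pow_mul]
    have x1 : f.natDegree ^ n * b ^ (m + n) = g.natDegree ^ n * (a ^ n * b ^ m) := by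
      rw [hd, he, mul_pow, mul_pow, pow_add]; ring
    have x2 : g.natDegree ^ m * a ^ (m + n) = f.natDegree ^ m * (a ^ n * b ^ m) := by
      rw [hd, he, mul_pow, mul_pow, pow_add]; ring
    have hrel2 := congrArg (fun w => w ^ (a ^ n * b ^ m)) hrel
    simp only [mul_pow, ← pow_mul] at hrel2
    rw [pow_add, add_mul, pow_add, add_comm n m] at hcond
    rw [x1, x2, ← hcond]
    have n1 := pow_ne_zero (g.natDegree ^ n * (a ^ n * b ^ m)) hu
    have n2 := pow_ne_zero (f.natDegree ^ m * (a ^ n * b ^ m)) hv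
    have n3 := pow_ne_zero (a ^ n * b ^ m) hv
    generalize u ^ (g.natDegree ^ n * (a ^ n * b ^ m)) = w1 at *
    generalize v ^ (f.natDegree ^ m * (a ^ n * b ^ m)) = w2 at *
    generalize v ^ (a ^ n * b ^ m) = w3 at *
    generalize u ^ (a ^ n * b ^ m) = w4 at *
    rw [div_mul_div_comm, div_eq_div_iff (mul_ne_zero n1 n3) n2]
    linear_combination γ ^ (i * b ^ (m + n)) * γ ^ (t * (a ^ n * b ^ m)) * hrel2
  · intro x y z h1 h2
    apply Rel.pow_eq S.hγ
    apply S.symm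
    have e1 : Rel γ (F.eval x) ((it f n).eval x) := ⟨i, by rw [hF, eval_mul, eval_C]⟩
    have e2 : Rel γ (G.eval y) ((it g m).eval y) := ⟨j, by rw [hG, eval_mul, eval_C]⟩
    have e3 : Rel γ ((it f m).eval y) (P.eval x) := by
      apply S.symm
      exact ⟨t, by rw [h1, hQ, eval_mul, eval_C]⟩
    rw [← h2] at e1
    have c : ∀ m n z, Rel γ ((it f m).eval ((it g n).eval z)) ((it g n).eval ((it f m).eval z)) :=
      fun m n z => ⟨_, S.comm_it m n z⟩
    have s1 : Rel γ (A.eval (G.eval y)) (A.eval ((it g m).eval y)) := e2.map f S.rotf _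
    have s2 := s1.trans (c (n + m) m y)
    have s3 : (it g m).eval ((it f (n + m)).eval y) =
        (it g m).eval ((it f n).eval ((it f m).eval y)) := by
      rw [it_add, eval_comp]
    rw [s3] at s2
    have s4 := s2.trans ((e3.map f S.rotf n).map g S.rotg m)
    have s5 := s4.trans ((c n n x).map g S.rotg m)
    have s6 : (it g m).eval ((it g n).eval ((it f n).eval x)) =
        (it g (n + m)).eval ((it f n).eval x) := by
      rw [add_comm n m, it_add, eval_comp]
    rw [s6] at s5
    have s7 := s5.trans ((S.symm e1).map g S.rotg (n + m))
    exact s7.trans (S.symm (c (n + m) (n + m) z))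

end

end Stmt15

namespace Stmt15

/-- Finite unions of arithmetic progressions. -/
def IsAPU (S : Set ℕ) : Prop :=
  ∃ s : Finset (ℕ × ℕ), S = ⋃ p ∈ s, {n : ℕ | ∃ k : ℕ, n = p.1 + p.2 * k}

lemma IsAPU.empty : IsAPU ∅ := ⟨∅, by simp⟩

lemma IsAPU.ap (a d : ℕ) : IsAPU {n : ℕ | ∃ k : ℕ, n = a + d * k} := ⟨{(a, d)}, by simp⟩

lemma IsAPU.singleton (a : ℕ) : IsAPU {a} := by
  have := IsAPU.ap a 0
  simpa using this

lemma IsAPU.univ : IsAPU Set.univ := by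
  have := IsAPU.ap 0 1
  simpa using this

lemma IsAPU.union {S T : Set ℕ} (hS : IsAPU S) (hT : IsAPU T) : IsAPU (S ∪ T) := by
  classical
  obtain ⟨s, rfl⟩ := hS
  obtain ⟨t, rfl⟩ := hT
  exact ⟨s ∪ t, by rw [Finset.set_biUnion_union]⟩

lemma IsAPU.biUnion {ι : Type*} (I : Finset ι) (S : ι → Set ℕ) (h : ∀ i ∈ I, IsAPU (S i)) :
    IsAPU (⋃ i ∈ I, S i) := by
  classical
  induction I using Finset.induction with
  | empty => simpa using IsAPU.empty
  | insert i I _ ih =>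
    rw [Finset.set_biUnion_insert]
    exact (h i (Finset.mem_insert_self i I)).union
      (ih fun j hj => h j (Finset.mem_insert_of_mem hj))

lemma IsAPU.of_shift (U : Set ℕ) (t : ℕ) (ht : 0 < t) (hU : ∀ n ∈ U, n + t ∈ U) : IsAPU U := by
  classical
  have hdec : U = ⋃ r ∈ Finset.range t, {n | n ∈ U ∧ n % t = r} := by
    ext n
    simp only [Set.mem_iUnion, Finset.mem_range, Set.mem_ofPred_eq, exists_prop]
    exact ⟨fun h => ⟨n % t, Nat.mod_lt _ ht, h, rfl⟩, fun ⟨_, _, h, _⟩ => h⟩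
  rw [hdec]
  apply IsAPU.biUnion
  intro r _
  by_cases hne : ∃ n, n ∈ U ∧ n % t = r
  · have hm := Nat.find_spec hne
    set m := Nat.find hne with hmdef
    convert IsAPU.ap m t using 1
    ext n
    simp only [Set.mem_ofPred_eq]
    constructor
    · rintro ⟨h1, h2⟩
      have hle : m ≤ n := Nat.find_min' hne ⟨h1, h2⟩
      have hmod : m ≡ n [MOD t] := by
        rw [Nat.ModEq, hm.2, h2]
      obtain ⟨k, hk⟩ := (Nat.modEq_iff_dvd' hle).mp hmod
      exact ⟨k, by omega⟩
    · rintro ⟨k, rfl⟩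
      refine ⟨?_, by rw [Nat.add_mul_mod_self_left, hm.2]⟩
      induction k with
      | zero => simpa using hm.1
      | succ k ih =>
        rw [Nat.mul_succ, ← add_assoc]
        exact hU _ ih
  · convert IsAPU.empty
    ext n
    simp only [Set.mem_ofPred_eq, Set.mem_empty_iff_false, iff_false]
    exact fun h => hne ⟨n, h⟩

lemma IsAPU.of_classes (S : Set ℕ) (n0 T : ℕ) (hT : 0 < T)
    (h : ∀ n1 ∈ S, n0 ≤ n1 → ∃ t, 0 < t ∧ T ∣ t ∧
      ∀ n ∈ S, n0 ≤ n → n % T = n1 % T → n + t ∈ S) : IsAPU S := by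
  classical
  have hdec : S = (⋃ n ∈ (Finset.range n0).filter (· ∈ S), {n}) ∪
      ⋃ r ∈ Finset.range T, {n | n ∈ S ∧ n0 ≤ n ∧ n % T = r} := by
    ext n
    simp only [Set.mem_union, Set.mem_iUnion, Finset.mem_range, Set.mem_ofPred_eq, exists_prop,
      Finset.mem_filter, Set.mem_singleton_iff]
    constructor
    · intro hn
      rcases lt_or_ge n n0 with hlt | hge
      · exact Or.inl ⟨n, ⟨hlt, hn⟩, rfl⟩
      · exact Or.inr ⟨n % T, Nat.mod_lt _ hT, hn, hge, rfl⟩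
    · rintro (⟨m, hm, rfl⟩ | ⟨_, _, h, _⟩)
      · exact hm.2
      · exact h
  rw [hdec]
  refine (IsAPU.biUnion _ _ fun n _ => IsAPU.singleton n).union (IsAPU.biUnion _ _ fun r _ => ?_)
  by_cases hne : ∃ n, n ∈ S ∧ n0 ≤ n ∧ n % T = r
  · obtain ⟨n1, h1, h2, h3⟩ := hne
    obtain ⟨t, ht, hTt, hsh⟩ := h n1 h1 h2
    apply IsAPU.of_shift _ t ht
    rintro n ⟨g1, g2, g3⟩
    refine ⟨hsh n g1 g2 (g3.trans h3.symm), by omega, ?_⟩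
    obtain ⟨k, rfl⟩ := hTt
    rw [Nat.add_mul_mod_self_left, g3]
  · convert IsAPU.empty
    ext n
    simp only [Set.mem_ofPred_eq, Set.mem_empty_iff_false, iff_false]
    exact fun h => hne ⟨n, h⟩

section ring
variable {R : Type*} [CommRing R]

/-- The complete homogeneous sums in two variables. -/
def hh (α β : R) : ℕ → R
  | 0 => 0
  | j + 1 => β * hh α β j + α ^ j

lemma hh_symm (α β : R) (n : ℕ) : β * hh α β n + α ^ n = α * hh α β n + β ^ n := by
  induction n with
  | zero => simp [hh]
  | succ n ih =>
    simp only [hh]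
    linear_combination β * ih

lemma hh_add (α β : R) (j T : ℕ) : hh α β (j + T) = β ^ T * hh α β j + α ^ j * hh α β T := by
  induction j with
  | zero => simp [hh]
  | succ j ih =>
    rw [show j + 1 + T = (j + T) + 1 by ring, hh, ih, hh]
    linear_combination α ^ j * hh_symm α β T

lemma hh_one (α β u v : R) (T s : ℕ) (hT : 0 < T) (hs : 0 < s) (hs0 : (s : R) = 0)
    (hα : α ^ (T + 1) = α)
    (hβ : β ^ (T + 1) = β) (huv : u * α + v * β = 1) : hh α β (1 + T * s) = 1 := by
  have idem : ∀ x : R, x ^ (T + 1) = x → ∀ k, 0 < k → x ^ (T * k) = x ^ T := by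
    intro x hx k hk
    induction k with
    | zero => omega
    | succ k ih =>
      rcases Nat.eq_zero_or_pos k with rfl | hk
      · simp
      · rw [Nat.mul_succ, pow_add, ih hk]
        obtain ⟨T', rfl⟩ : ∃ T', T = T' + 1 := ⟨T - 1, by omega⟩
        rw [pow_succ x T']
        rw [pow_succ, pow_succ] at hx
        linear_combination x ^ T' * hx
  have hε0 : (1 - α ^ T) * α = 0 := by
    rw [pow_succ] at hα
    linear_combination -hα
  have hδ0 : (1 - β ^ T) * β = 0 := by
    rw [pow_succ] at hβ
    linear_combination -hβ
  have hεδ : (1 - α ^ T) * (1 - β ^ T) = 0 := by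
    linear_combination (-(1 - α ^ T) * (1 - β ^ T)) * huv + u * (1 - β ^ T) * hε0 +
      v * (1 - α ^ T) * hδ0
  have e1 : (1 - α ^ T) * hh α β (1 + T * s) = 1 - α ^ T := by
    rw [add_comm 1, hh, hh_symm, idem β hβ s hs]
    linear_combination hh α β (T * s) * hε0 - hεδ
  have e2 : (1 - β ^ T) * hh α β (1 + T * s) = 1 - β ^ T := by
    rw [add_comm 1, hh, idem α hα s hs]
    linear_combination hh α β (T * s) * hδ0 - hεδ
  have e3 : ∀ k : ℕ, α ^ T * β ^ T * hh α β (1 + T * k) =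
      α ^ T * β ^ T * (1 + k * α * hh α β T) := by
    intro k
    induction k with
    | zero => simp [hh]
    | succ k ih =>
      have h1 : α ^ (1 + T * k) = α := by
        rcases Nat.eq_zero_or_pos k with rfl | hk
        · simp
        · rw [add_comm, pow_succ, idem α hα k hk, ← pow_succ, hα]
      have h2 : β ^ T * β ^ T = β ^ T := by
        have := idem β hβ 2 (by norm_num)
        rwa [mul_two, pow_add] at this
      rw [Nat.mul_succ, ← add_assoc, hh_add, h1]
      push_cast
      linear_combination (α ^ T * hh α β (1 + T * k)) * h2 + ih
  have e4 := e3 s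
  rw [hs0] at e4
  linear_combination e1 + α ^ T * e2 + e4

end ring

lemma bez (A B : ℕ) (hAB : Nat.Coprime A B) (M : ℕ) (hM : 0 < M) (r : ℤ) :
    ∃ I J : ℕ, ∃ w : ℤ, (J : ℤ) * A - I * B = r + M * w := by
  have hb := Nat.gcd_eq_gcd_ab A B
  rw [hAB] at hb
  set u := Nat.gcdA A B
  set v := Nat.gcdB A B
  have hM' : (M : ℤ) ≠ 0 := by exact_mod_cast hM.ne'
  refine ⟨((-v * r) % M).toNat, ((u * r) % M).toNat, -((u * r) / M) * A + ((-v * r) / M) * B, ?_⟩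
  rw [Int.toNat_of_nonneg (Int.emod_nonneg _ hM'), Int.toNat_of_nonneg (Int.emod_nonneg _ hM')]
  have h1 := Int.emod_add_mul_ediv (u * r) M
  have h2 := Int.emod_add_mul_ediv (-v * r) M
  push_cast at hb
  linear_combination A * h1 - B * h2 - r * hb

lemma pow_eq_of_int {γ : ℂ} {M : ℕ} (hM : 0 < M) (hγ : γ ^ M = 1) (u v : ℕ) (w : ℤ)
    (h : (u : ℤ) = v + M * w) : γ ^ u = γ ^ v := by
  have hγ0 : γ ≠ 0 := by
    rintro rfl
    rw [zero_pow hM.ne'] at hγ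
    exact zero_ne_one hγ
  rw [← zpow_natCast, h, zpow_add₀ hγ0, zpow_mul, zpow_natCast, zpow_natCast, hγ, one_zpow, mul_one]

section comb
variable {f g : ℂ[X]} {γ : ℂ} {M : ℕ}

/-- The bookkeeping relation. -/
def DD (f g : ℂ[X]) (γ c : ℂ) (a b d' M' n : ℕ) (k : ZMod M') : Prop :=
  ∃ i j : ℕ, ∃ x, (it f n).eval x = γ ^ i * c ∧ (it g n).eval x = γ ^ j * c ∧
    k = d' * (j * a ^ n - i * b ^ n) - gs g.natDegree n * a ^ n

lemma gs_add (x m n : ℕ) : gs x (m + n) = gs x m + x ^ m * gs x n := by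
  simp only [gs, Finset.sum_range_add, pow_add, Finset.mul_sum]

lemma gs_mul (d' m : ℕ) : d' * gs (d' + 1) m + 1 = (d' + 1) ^ m := by
  induction m with
  | zero => simp [gs]
  | succ m ih =>
    rw [gs_succ, pow_succ, ← ih]
    ring

lemma Setting.mul (S : Setting f g γ M) (c : ℂ) (q a b d' : ℕ) (hd : f.natDegree = q * a)
    (he : g.natDegree = q * b) (hd' : f.natDegree = d' + 1) (hab : Nat.Coprime a b) (n m : ℕ)
    (k k' : ZMod (M * d')) (h1 : DD f g γ c a b d' (M * d') n k)
    (h2 : DD f g γ c a b d' (M * d') m k') :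
    DD f g γ c a b d' (M * d') (n + m) (k * b ^ m + k' * a ^ n) := by
  obtain ⟨i, j, x, hx1, hx2, rfl⟩ := h1
  obtain ⟨i', j', y, hy1, hy2, rfl⟩ := h2
  have hM := S.hM
  obtain ⟨I, J, w, hIJ⟩ := bez (a ^ (n + m)) (b ^ (n + m)) (Nat.Coprime.pow _ _ hab) M S.hM
    ((j + (M - 1) * i' + gs f.natDegree m * gs g.natDegree n) * (a ^ n * b ^ m))
  obtain ⟨z, hz1, hz2⟩ := S.glue q a b hd he hab n m I J (j + (M - 1) * i')
    (by
      symm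
      apply pow_eq_of_int S.hM S.hγ _ _ w
      push_cast [Nat.cast_sub (show 1 ≤ M from hM)]
      push_cast at hIJ
      linear_combination hIJ)
    x y
    (by
      rw [hx2, hy1, ← mul_assoc, ← pow_add]
      congr 1
      apply pow_eq_of_int S.hM S.hγ _ _ (-i')
      push_cast [Nat.cast_sub (show 1 ≤ M from hM)]
      ring)
  refine ⟨I + i, J + j', z, ?_, ?_, ?_⟩
  · rw [hz1, hx1, pow_add, mul_assoc]
  · rw [hz2, hy2, pow_add, mul_assoc]
  · have hIJ' := congrArg (fun t : ℤ => (t : ZMod (M * d'))) hIJ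
    push_cast at hIJ' ⊢
    have hM0 : (M : ZMod (M * d')) * d' = 0 := by
      rw [← Nat.cast_mul]
      exact ZMod.natCast_self _
    have hg1 : (d' : ZMod (M * d')) * gs f.natDegree m + 1 = (f.natDegree : ZMod (M * d')) ^ m := by
      have := congrArg (fun t : ℕ => (t : ZMod (M * d'))) (gs_mul d' m)
      rw [hd']
      push_cast at this ⊢
      exact this
    have hg2 : (gs g.natDegree (n + m) : ZMod (M * d')) =
        gs g.natDegree m + (g.natDegree : ZMod (M * d')) ^ m * gs g.natDegree n := by
      rw [add_comm n m, gs_add]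
      push_cast
      ring
    have hde : (g.natDegree : ZMod (M * d')) ^ m * a ^ m = (f.natDegree : ZMod (M * d')) ^ m * b ^ m := by
      rw [he, hd]
      push_cast
      ring
    rw [hg2]
    simp only [pow_add] at hIJ' ⊢
    linear_combination (-(d' : ZMod (M * d'))) * hIJ' - (i' * a ^ n * b ^ m + w) * hM0 -
      gs g.natDegree n * a ^ n * b ^ m * hg1 + gs g.natDegree n * a ^ n * hde

lemma Setting.mem_iff (S : Setting f g γ M) (c : ℂ) (q a b d' : ℕ) (hd0 : 0 < d')
    (hd : f.natDegree = q * a)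
    (he : g.natDegree = q * b) (hab : Nat.Coprime a b) (n : ℕ) :
    (∃ x, (it f n).eval x = c ∧ (it g n).eval x = c) ↔
    DD f g γ c a b d' (M * d') n (-(gs g.natDegree n * a ^ n)) := by
  constructor
  · rintro ⟨x, h1, h2⟩
    exact ⟨0, 0, x, by simpa using h1, by simpa using h2, by simp⟩
  · rintro ⟨i, j, x, h1, h2, h3⟩
    have hM := S.hM
    have h4 : ((d' * (j * a ^ n - i * b ^ n) : ℤ) : ZMod (M * d')) = 0 := by
      push_cast
      linear_combination -h3
    rw [ZMod.intCast_zmod_eq_zero_iff_dvd] at h4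
    obtain ⟨w, hw⟩ := h4
    have hw' : ((j : ℤ) * a ^ n - i * b ^ n) = M * w := by
      have : (d' : ℤ) ≠ 0 := by exact_mod_cast hd0.ne'
      apply mul_left_cancel₀ this
      push_cast at hw
      linear_combination hw
    obtain ⟨z, hz1, hz2⟩ := S.glue q a b hd he hab n 0 ((M - 1) * i) ((M - 1) * j) 0
      (by
        apply pow_eq_of_int S.hM S.hγ _ _ (-((M - 1) * w))
        push_cast [Nat.cast_sub (show 1 ≤ M from hM)]
        simp only [gs_zero, add_zero, pow_zero]
        push_cast
        linear_combination -((M : ℤ) - 1) * hw')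
      x ((it g n).eval x) (by simp [it])
    have hr : ∀ i : ℕ, γ ^ ((M - 1) * i) * (γ ^ i * c) = c := by
      intro i
      rw [← mul_assoc, ← pow_add]
      have : γ ^ ((M - 1) * i + i) = γ ^ 0 := by
        apply pow_eq_of_int S.hM S.hγ _ _ i
        push_cast [Nat.cast_sub (show 1 ≤ M from hM)]
        ring
      rw [this]
      simp
    refine ⟨z, ?_, ?_⟩
    · rw [add_zero] at hz1
      rw [hz1, h1, hr]
    · rw [add_zero] at hz2
      rw [hz2, h2]
      simp only [it, Function.iterate_zero, id_eq, eval_X]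
      exact hr j

end comb

end Stmt15

namespace Stmt15

section comb
variable {f g : ℂ[X]} {γ : ℂ} {M : ℕ}

lemma exists_period (R : Type*) [CommRing R] [Finite R] (a b e : ℕ) :
    ∃ n0 T : ℕ, 0 < T ∧ ∀ n, n0 ≤ n → ∀ s, (a : R) ^ (n + T * s) = a ^ n ∧
      (b : R) ^ (n + T * s) = b ^ n ∧ (gs e (n + T * s) : R) = gs e n := by
  let φ : R × R × R → R × R × R := fun p => (a * p.1, b * p.2.1, e * p.2.2 + 1)
  have horb : ∀ n, φ^[n] (1, 1, 0) = ((a : R) ^ n, (b : R) ^ n, (gs e n : R)) := by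
    intro n
    induction n with
    | zero => simp [gs]
    | succ n ih =>
      rw [Function.iterate_succ_apply', ih]
      simp only [φ, gs_succ, pow_succ']
      push_cast
      rfl
  have : ∃ n0 T : ℕ, 0 < T ∧ φ^[n0 + T] (1, 1, 0) = φ^[n0] (1, 1, 0) := by
    obtain ⟨m, n, hmn, h⟩ := Finite.exists_ne_map_eq_of_infinite (fun n => φ^[n] (1, 1, 0))
    rcases lt_or_gt_of_ne hmn with hlt | hlt
    · exact ⟨m, n - m, by omega, by rw [Nat.add_sub_cancel' hlt.le]; exact h.symm⟩
    · exact ⟨n, m - n, by omega, by rw [Nat.add_sub_cancel' hlt.le]; exact h⟩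
  obtain ⟨n0, T, hT, h0⟩ := this
  have h1 : ∀ n, n0 ≤ n → φ^[n + T] (1, 1, 0) = φ^[n] (1, 1, 0) := by
    intro n hn
    obtain ⟨k, rfl⟩ := Nat.exists_eq_add_of_le hn
    rw [show n0 + k + T = k + (n0 + T) by ring, Function.iterate_add_apply, h0, add_comm n0 k,
      Function.iterate_add_apply φ k n0]
  have h2 : ∀ s n, n0 ≤ n → φ^[n + T * s] (1, 1, 0) = φ^[n] (1, 1, 0) := by
    intro s
    induction s with
    | zero => simp
    | succ s ih =>
      intro n hn
      rw [Nat.mul_succ, ← add_assoc, h1 _ (by omega), ih n hn]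
  refine ⟨n0, T, hT, fun n hn s => ?_⟩
  have := h2 s n hn
  rw [horb, horb, Prod.mk.injEq, Prod.mk.injEq] at this
  exact this

lemma Setting.apu (S : Setting f g γ M) (hf2 : 2 ≤ f.natDegree) (c : ℂ) :
    IsAPU {n | ∃ x, (it f n).eval x = c ∧ (it g n).eval x = c} := by
  obtain ⟨d', hd'⟩ : ∃ d', f.natDegree = d' + 1 := ⟨f.natDegree - 1, by omega⟩
  have hd0 : 0 < d' := by omega
  have hq0 : 0 < Nat.gcd f.natDegree g.natDegree := Nat.gcd_pos_of_pos_left _ S.hf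
  obtain ⟨q, hq⟩ : ∃ q, q = Nat.gcd f.natDegree g.natDegree := ⟨_, rfl⟩
  obtain ⟨a, ha⟩ := Nat.gcd_dvd_left f.natDegree g.natDegree
  obtain ⟨b, hb⟩ := Nat.gcd_dvd_right f.natDegree g.natDegree
  rw [← hq] at ha hb hq0
  have hab : Nat.Coprime a b := by
    have : q * Nat.gcd a b = q * 1 := by rw [← Nat.gcd_mul_left, ← ha, ← hb, mul_one, hq]
    exact Nat.eq_of_mul_eq_mul_left hq0 this
  have hM := S.hM
  have hM' : 0 < M * d' := Nat.mul_pos hM hd0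
  have : NeZero (M * d') := ⟨hM'.ne'⟩
  obtain ⟨n0, T, hT, hper⟩ := exists_period (ZMod (M * d')) a b g.natDegree
  have hmem := fun n => S.mem_iff c q a b d' hd0 ha hb hab n
  apply IsAPU.of_classes _ (n0 + 1) T hT
  intro n1 hn1 hn1'
  refine ⟨T * (M * d') * n1, Nat.mul_pos (Nat.mul_pos hT hM') (by omega), ⟨M * d' * n1, by ring⟩, ?_⟩
  intro n hn hn' hmod
  rw [Set.mem_ofPred_eq, hmem] at hn hn1 ⊢
  have hsame : (a : ZMod (M * d')) ^ n = a ^ n1 ∧ (b : ZMod (M * d')) ^ n = b ^ n1 ∧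
      (gs g.natDegree n : ZMod (M * d')) = gs g.natDegree n1 := by
    rcases le_total n n1 with hle | hle
    · obtain ⟨k, hk⟩ := (Nat.modEq_iff_dvd' hle).mp hmod
      have : n1 = n + T * k := by omega
      obtain ⟨p1, p2, p3⟩ := hper n (by omega) k
      rw [this]
      exact ⟨p1.symm, p2.symm, p3.symm⟩
    · obtain ⟨k, hk⟩ := (Nat.modEq_iff_dvd' hle).mp hmod.symm
      have : n = n1 + T * k := by omega
      rw [this]
      exact hper n1 (by omega) k
  obtain ⟨s1, s2, s3⟩ := hsame
  set k : ZMod (M * d') := -(gs g.natDegree n1 * a ^ n1) with hk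
  rw [s1, s3] at hn
  set α : ZMod (M * d') := a ^ n1 with hα
  set β : ZMod (M * d') := b ^ n1 with hβ
  have hind : ∀ j : ℕ, DD f g γ c a b d' (M * d') (n + j * n1) (k * hh α β (j + 1)) := by
    intro j
    induction j with
    | zero => simpa [hh] using hn
    | succ j ih =>
      have := S.mul c q a b d' ha hb hd' hab _ _ _ _ ih hn1
      convert this using 1
      · ring
      · have e : (a : ZMod (M * d')) ^ (n + j * n1) = α ^ (j + 1) := by
          rw [pow_add, s1, mul_comm j n1, pow_mul, ← hα, pow_succ']
        rw [hh, e, ← hβ]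
        ring
  have hαT : α ^ (T + 1) = α := by
    rw [hα, ← pow_mul, show n1 * (T + 1) = n1 + T * n1 by ring]
    exact (hper n1 (by omega) n1).1
  have hβT : β ^ (T + 1) = β := by
    rw [hβ, ← pow_mul, show n1 * (T + 1) = n1 + T * n1 by ring]
    exact (hper n1 (by omega) n1).2.1
  have huv : ∃ u v : ZMod (M * d'), u * α + v * β = 1 := by
    have hb := Nat.gcd_eq_gcd_ab (a ^ n1) (b ^ n1)
    rw [Nat.Coprime.pow n1 n1 hab] at hb
    have := congrArg (fun t : ℤ => (t : ZMod (M * d'))) hb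
    push_cast at this
    exact ⟨((a ^ n1).gcdA (b ^ n1) : ℤ), ((a ^ n1).gcdB (b ^ n1) : ℤ), by rw [this, hα, hβ]; ring⟩
  obtain ⟨u, v, huv⟩ := huv
  have hone := hh_one α β u v T (M * d') hT hM' (ZMod.natCast_self _) hαT hβT huv
  have := hind (T * (M * d'))
  rw [add_comm _ 1, hone, mul_one] at this
  obtain ⟨p1, p2, p3⟩ := hper n (by omega) (M * d' * n1)
  rw [show T * (M * d') * n1 = T * (M * d' * n1) by ring] at this ⊢
  rw [p1, p3, s1, s3]
  exact this

end comb

end Stmt15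

namespace Stmt15

lemma newton_eq {N : ℕ} (x y : Fin N → ℂ)
    (h : ∀ j < N, (MvPolynomial.esymm (Fin N) ℂ j).aeval x =
      (MvPolynomial.esymm (Fin N) ℂ j).aeval y)
    (k : ℕ) (hk : k < N) : ∑ i, x i ^ k = ∑ i, y i ^ k := by
  have hps : ∀ k (x : Fin N → ℂ),
      MvPolynomial.aeval x (MvPolynomial.psum (Fin N) ℂ k) = ∑ i, x i ^ k := by
    intro k x
    simp [MvPolynomial.psum]
  induction k using Nat.strong_induction_on with
  | _ k ih =>
    rcases Nat.eq_zero_or_pos k with rfl | hk0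
    · simp
    · rw [← hps, ← hps, MvPolynomial.psum_eq_mul_esymm_sub_sum (Fin N) ℂ k hk0]
      simp only [map_sub, map_mul, map_sum, map_pow, map_neg, map_one, map_natCast]
      rw [h k hk]
      congr 1
      apply Finset.sum_congr rfl
      intro p hp
      obtain ⟨hp1, hp2⟩ := Finset.mem_filter.mp hp
      have hp3 := Finset.HasAntidiagonal.mem_antidiagonal.mp hp1
      have hp4 := Set.mem_Ioo.mp hp2
      rw [h p.1 (by omega), hps, hps, ih p.2 (by omega) (by omega)]

lemma exists_fin_fun (s : Multiset ℂ) (N : ℕ) (h : s.card = N) :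
    ∃ x : Fin N → ℂ, s = Finset.univ.val.map x := by
  obtain ⟨l, rfl⟩ := Quot.exists_rep s
  have h' : l.length = N := h
  subst h'
  refine ⟨fun i => l.get i, ?_⟩
  rw [Fin.univ_val_map, List.ofFn_get]
  rfl

/-- The sum over a fibre of a polynomial of smaller degree does not depend on the fibre. -/
lemma fibre_sum (A r : ℂ[X]) (hr : r.natDegree < A.natDegree) (w w' : ℂ) :
    ((A - C w).roots.map (fun z => r.eval z)).sum = ((A - C w').roots.map (fun z => r.eval z)).sum := by
  have hA : 0 < A.natDegree := by omega
  have hcard : ∀ w, (A - C w).roots.card = A.natDegree := fun w => by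
    rw [splits_iff_card_roots.mp (IsAlgClosed.splits _), natDegree_sub_C]
  have hlc : ∀ w, (A - C w).leadingCoeff = A.leadingCoeff := fun w => by
    rw [leadingCoeff, leadingCoeff, natDegree_sub_C, coeff_sub, coeff_C_of_ne_zero hA.ne', sub_zero]
  have hes : ∀ w w', ∀ j < A.natDegree, (A - C w).roots.esymm j = (A - C w').roots.esymm j := by
    intro w w' j hj
    have key : ∀ w, A.coeff (A.natDegree - j) =
        A.leadingCoeff * (-1) ^ j * (A - C w).roots.esymm j := by
      intro w
      have := coeff_eq_esymm_roots_of_card (p := A - C w)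
        (by rw [hcard, natDegree_sub_C]) (k := A.natDegree - j) (by rw [natDegree_sub_C]; omega)
      rw [hlc, natDegree_sub_C, Nat.sub_sub_self hj.le, coeff_sub, coeff_C_of_ne_zero (by omega),
        sub_zero] at this
      exact this
    have h := (key w).symm.trans (key w')
    have hne : A.leadingCoeff * (-1) ^ j ≠ 0 := mul_ne_zero (lc_ne hA) (by simp)
    exact mul_left_cancel₀ hne h
  obtain ⟨x, hx⟩ := exists_fin_fun _ _ (hcard w)
  obtain ⟨y, hy⟩ := exists_fin_fun _ _ (hcard w')
  have hn := newton_eq x y (by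
    intro j hj
    rw [MvPolynomial.aeval_esymm_eq_multiset_esymm, MvPolynomial.aeval_esymm_eq_multiset_esymm,
      ← hx, ← hy]
    exact hes w w' j hj)
  have hsum : ∀ x : Fin A.natDegree → ℂ,
      (((Finset.univ.val.map x) : Multiset ℂ).map (fun z => r.eval z)).sum =
      ∑ k ∈ Finset.range (r.natDegree + 1), r.coeff k * ∑ i, x i ^ k := by
    intro x
    rw [Multiset.map_map]
    change ∑ i, r.eval (x i) = _
    simp only [eval_eq_sum_range, Finset.mul_sum]
    rw [Finset.sum_comm]
  rw [hx, hy, hsum, hsum]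
  apply Finset.sum_congr rfl
  intro k hk
  rw [hn k (by have := Finset.mem_range.mp hk; omega)]

lemma dvd_mul_derivative (p r : ℂ[X]) (hp : 0 < p.natDegree) (h : ∀ z, p.eval z = 0 → r.eval z = 0) :
    p ∣ r * derivative p := by
  classical
  have hp0 : p ≠ 0 := by rintro rfl; simp at hp
  have hd0 : derivative p ≠ 0 := by
    intro h
    have := derivative_eq_zero.mp h
    omega
  rcases eq_or_ne r 0 with rfl | hr
  · simp
  have hrp := mul_ne_zero hr hd0
  apply Splits.dvd_of_roots_le_roots (IsAlgClosed.splits p) hp0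
  rw [Multiset.le_iff_count]
  intro z
  rw [count_roots, count_roots, rootMultiplicity_mul hrp]
  have h1 := rootMultiplicity_sub_one_le_derivative_rootMultiplicity_of_ne_zero p z hd0
  by_cases hz : p.eval z = 0
  · have : 0 < r.rootMultiplicity z := (rootMultiplicity_pos hr).mpr (h z hz)
    omega
  · have : p.rootMultiplicity z = 0 := rootMultiplicity_eq_zero hz
    omega

/-- Equality case of the triangle inequality. -/
lemma avg_eq (s : Multiset ℂ) (R : ℝ) (w : ℂ) (hw : ‖w‖ = R) (h : ∀ z ∈ s, ‖z‖ ≤ R)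
    (hs : s.sum = s.card * w) : ∀ z ∈ s, z = w := by
  set φ : ℂ → ℝ := fun z => R ^ 2 - (z * (starRingEnd ℂ) w).re with hφ
  have hnn : ∀ z, ‖z‖ ≤ R → 0 ≤ φ z := by
    intro z hz
    have h1 : (z * (starRingEnd ℂ) w).re ≤ ‖z‖ * ‖w‖ := by
      refine (Complex.re_le_norm _).trans ?_
      simp
    have h2 : ‖z‖ * ‖w‖ ≤ R * R := by
      rw [hw]
      exact mul_le_mul_of_nonneg_right hz (hw ▸ norm_nonneg w)
    simp only [hφ]
    nlinarith
  have hsum : (s.map φ).sum = 0 := by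
    have : ∀ s : Multiset ℂ, (s.map φ).sum =
        s.card * R ^ 2 - (s.sum * (starRingEnd ℂ) w).re := by
      intro s
      induction s using Multiset.induction with
      | empty => simp
      | cons a s ih =>
        rw [Multiset.map_cons, Multiset.sum_cons, ih, Multiset.card_cons, Multiset.sum_cons, add_mul,
          Complex.add_re]
        simp only [hφ]
        push_cast
        ring
    rw [this, hs, mul_assoc, Complex.mul_conj, Complex.normSq_eq_norm_sq, hw]
    norm_cast
    simp
  intro z hz
  have h0 : φ z = 0 := by
    obtain ⟨t, rfl⟩ := Multiset.exists_cons_of_mem hz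
    rw [Multiset.map_cons, Multiset.sum_cons] at hsum
    have h1 : 0 ≤ (t.map φ).sum := by
      apply Multiset.sum_nonneg
      intro x hx
      obtain ⟨u, hu, rfl⟩ := Multiset.mem_map.mp hx
      exact hnn u (h u (Multiset.mem_cons_of_mem hu))
    have h2 := hnn z (h z hz)
    linarith
  have hd : ‖z - w‖ ^ 2 ≤ 0 := by
    rw [← Complex.normSq_eq_norm_sq, Complex.normSq_sub, Complex.normSq_eq_norm_sq,
      Complex.normSq_eq_norm_sq, hw]
    simp only [hφ] at h0
    have := h z hz
    have : ‖z‖ ^ 2 ≤ R ^ 2 := pow_le_pow_left₀ (norm_nonneg z) this 2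
    linarith
  have : ‖z - w‖ = 0 := by
    have := norm_nonneg (z - w)
    nlinarith
  exact sub_eq_zero.mp (norm_eq_zero.mp this)

/-- A compact set normalized to have minimal enclosing disc centred at zero. -/
structure Disc (K : Set ℂ) (R : ℝ) : Prop where
  bd : ∀ w ∈ K, ‖w‖ ≤ R
  uniq : ∀ t : ℂ, (∀ w ∈ K, ‖w + t‖ ≤ R) → t = 0
  two : ∃ w1 ∈ K, ∃ w2 ∈ K, w1 ≠ w2 ∧ ‖w1‖ = R ∧ ‖w2‖ = R

lemma Disc.cheb_aux {K : Set ℂ} {R : ℝ} (D : Disc K R) (A Q : ℂ[X]) (hA : 0 < A.natDegree)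
    (hQ : Q.natDegree = A.natDegree) (hlc : Q.leadingCoeff = A.leadingCoeff)
    (hAK : ∀ z, A.eval z ∈ K → z ∈ K) (hQK : ∀ z ∈ K, ‖Q.eval z‖ ≤ R) : Q = A := by
  set r := Q - A with hrdef
  have hA0 : A ≠ 0 := by rintro rfl; simp at hA
  have hrdeg : r.natDegree < A.natDegree := by
    rcases eq_or_ne r 0 with h | h
    · rw [h]; simpa using hA
    · apply natDegree_lt_natDegree h
      exact degree_sub_lt_right (by
        have hQ0 : Q ≠ 0 := by rintro rfl; simp at hQ; omega
        rw [degree_eq_natDegree hQ0, degree_eq_natDegree hA0, hQ]) hA0 hlc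
  have hcard : ∀ w, (A - C w).roots.card = A.natDegree := fun w => by
    rw [splits_iff_card_roots.mp (IsAlgClosed.splits _), natDegree_sub_C]
  have hAw : ∀ w, A - C w ≠ 0 := by
    intro w h
    have := natDegree_sub_C (p := A) (a := w)
    rw [h, natDegree_zero] at this
    omega
  have hroot : ∀ w z, z ∈ (A - C w).roots ↔ A.eval z = w := by
    intro w z
    rw [mem_roots (hAw w)]
    simp [sub_eq_zero]
  set τ := ((A - C 0).roots.map (fun z => r.eval z)).sum with hτ
  have hNc : (A.natDegree : ℂ) ≠ 0 := by exact_mod_cast hA.ne'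
  have hsum : ∀ w, ((A - C w).roots.map (fun z => Q.eval z)).sum =
      A.natDegree * (w + τ / A.natDegree) := by
    intro w
    have h1 : (A - C w).roots.map (fun z => Q.eval z) =
        (A - C w).roots.map (fun z => w + r.eval z) := by
      apply Multiset.map_congr rfl
      intro z hz
      rw [hroot] at hz
      rw [hrdef, eval_sub, hz]
      ring
    rw [h1, Multiset.sum_map_add, fibre_sum A r hrdeg w 0, ← hτ]
    simp only [Multiset.map_const', Multiset.sum_replicate, hcard]
    rw [nsmul_eq_mul]
    field_simp
  have hb : ∀ w ∈ K, ∀ u ∈ (A - C w).roots.map (fun z => Q.eval z), ‖u‖ ≤ R := by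
    intro w hw u hu
    obtain ⟨z, hz, rfl⟩ := Multiset.mem_map.mp hu
    rw [hroot] at hz
    exact hQK z (hAK z (hz ▸ hw))
  have ht : τ / A.natDegree = 0 := by
    apply D.uniq
    intro w hw
    have h1 : ‖((A - C w).roots.map (fun z => Q.eval z)).sum‖ ≤ A.natDegree * R := by
      have gen : ∀ s : Multiset ℂ, (∀ u ∈ s, ‖u‖ ≤ R) → ‖s.sum‖ ≤ s.card * R := by
        intro s
        induction s using Multiset.induction with
        | empty => simp
        | cons a s ih =>
          intro h
          rw [Multiset.sum_cons, Multiset.card_cons]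
          push_cast
          have h1 := norm_add_le a s.sum
          have h2 := h a (Multiset.mem_cons_self a s)
          have h3 := ih fun u hu => h u (Multiset.mem_cons_of_mem hu)
          linarith
      have := gen _ (hb w hw)
      rwa [Multiset.card_map, hcard] at this
    rw [hsum, norm_mul, Complex.norm_natCast] at h1
    exact le_of_mul_le_mul_left h1 (by exact_mod_cast hA)
  have hzero : ∀ w ∈ K, ‖w‖ = R → ∀ z, (A - C w).eval z = 0 → r.eval z = 0 := by
    intro w hw hwR z hz
    have h1 := avg_eq ((A - C w).roots.map (fun z => Q.eval z)) R w hwR (hb w hw)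
      (by rw [hsum, ht, add_zero, Multiset.card_map, hcard])
    have hz' : A.eval z = w := by simpa [sub_eq_zero] using hz
    have h2 := h1 _ (Multiset.mem_map.mpr ⟨z, (hroot w z).mpr hz', rfl⟩)
    rw [hrdef, eval_sub, h2, hz', sub_self]
  obtain ⟨w1, hw1, w2, hw2, hne, hR1, hR2⟩ := D.two
  have hdv : ∀ w ∈ K, ‖w‖ = R → (A - C w) ∣ r * derivative A := by
    intro w hw hwR
    have := dvd_mul_derivative (A - C w) r (by rwa [natDegree_sub_C]) (hzero w hw hwR)
    simpa using this
  have hcop : IsCoprime (A - C w1) (A - C w2) := by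
    have hu : w2 - w1 ≠ 0 := sub_ne_zero.mpr hne.symm
    refine ⟨C (w2 - w1)⁻¹, -C (w2 - w1)⁻¹, ?_⟩
    have : C (w2 - w1)⁻¹ * (C w2 - C w1) = (1 : ℂ[X]) := by
      rw [← C_sub, ← C_mul, inv_mul_cancel₀ hu, C_1]
    linear_combination this
  have hdvd := hcop.mul_dvd (hdv w1 hw1 hR1) (hdv w2 hw2 hR2)
  by_contra hcon
  have hr0 : r ≠ 0 := sub_ne_zero.mpr hcon
  have hd0 : derivative A ≠ 0 := by
    intro h
    have := derivative_eq_zero.mp h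
    omega
  have h1 := natDegree_le_of_dvd hdvd (mul_ne_zero hr0 hd0)
  rw [natDegree_mul (hAw w1) (hAw w2), natDegree_sub_C, natDegree_sub_C,
    natDegree_mul hr0 hd0] at h1
  have h2 := natDegree_derivative_lt (p := A) hA.ne'
  omega

lemma Disc.cheb {K : Set ℂ} {R : ℝ} (D : Disc K R) (A B : ℂ[X]) (hA : 0 < A.natDegree)
    (hB : B.natDegree = A.natDegree)
    (hAK : ∀ z, A.eval z ∈ K ↔ z ∈ K) (hBK : ∀ z, B.eval z ∈ K ↔ z ∈ K) :
    B = C (B.leadingCoeff / A.leadingCoeff) * A := by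
  have aux : ∀ A B : ℂ[X], 0 < A.natDegree → B.natDegree = A.natDegree →
      (∀ z, A.eval z ∈ K ↔ z ∈ K) → (∀ z, B.eval z ∈ K ↔ z ∈ K) →
      ‖A.leadingCoeff‖ ≤ ‖B.leadingCoeff‖ → C (A.leadingCoeff / B.leadingCoeff) * B = A := by
    intro A B hA hB hAK hBK hle
    have lA := lc_ne hA
    have lB := lc_ne (hB ▸ hA : 0 < B.natDegree)
    apply D.cheb_aux A _ hA
    · rw [natDegree_C_mul (div_ne_zero lA lB), hB]
    · rw [leadingCoeff_mul, leadingCoeff_C]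
      field_simp
    · exact fun z hz => (hAK z).mp hz
    · intro z hz
      rw [eval_mul, eval_C, norm_mul, norm_div]
      have h1 := D.bd _ ((hBK z).mpr hz)
      have h2 : ‖A.leadingCoeff‖ / ‖B.leadingCoeff‖ ≤ 1 :=
        div_le_one_of_le₀ hle (norm_nonneg _)
      have := mul_le_mul h2 h1 (norm_nonneg _) zero_le_one
      linarith
  have lA := lc_ne hA
  have lB := lc_ne (hB ▸ hA : 0 < B.natDegree)
  rcases le_total ‖A.leadingCoeff‖ ‖B.leadingCoeff‖ with h | h
  · have := aux A B hA hB hAK hBK h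
    have e : C (B.leadingCoeff / A.leadingCoeff) * A = C (B.leadingCoeff / A.leadingCoeff) *
        (C (A.leadingCoeff / B.leadingCoeff) * B) := by rw [this]
    rw [e, ← mul_assoc, ← C_mul]
    have : B.leadingCoeff / A.leadingCoeff * (A.leadingCoeff / B.leadingCoeff) = 1 := by
      field_simp
    rw [this]
    simp
  · exact (aux B A (hB ▸ hA) hB.symm hBK hAK h).symm

end Stmt15

namespace Stmt15

lemma gs_strictMono (x : ℕ) (hx : 0 < x) {m n : ℕ} (h : m < n) : gs x m < gs x n := by
  have : StrictMono (gs x) := by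
    apply strictMono_nat_of_lt_succ
    intro n
    simp only [gs]
    rw [Finset.sum_range_succ]
    have : 0 < x ^ n := by positivity
    omega
  exact this h

lemma Disc.setting {K : Set ℂ} {R : ℝ} (D : Disc K R) (f g : ℂ[X]) (hf2 : 2 ≤ f.natDegree)
    (hg : 0 < g.natDegree) (hfK : ∀ z, f.eval z ∈ K ↔ z ∈ K) (hgK : ∀ z, g.eval z ∈ K ↔ z ∈ K)
    (hprep : ∀ x : ℂ, (Set.range fun n : ℕ => (fun y => f.eval y)^[n] x).Finite →
      (Set.range fun n : ℕ => (fun y => g.eval y)^[n] x).Finite) :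
    ∃ γ M, Setting f g γ M := by
  have hf : 0 < f.natDegree := by omega
  obtain ⟨γ, hγ0, hcomm⟩ : ∃ γ : ℂ, γ ≠ 0 ∧ f.comp g = C γ * g.comp f := by
    have hA : 0 < (g.comp f).natDegree := by rw [natDegree_comp]; positivity
    have hB : (f.comp g).natDegree = (g.comp f).natDegree := by
      rw [natDegree_comp, natDegree_comp, mul_comm]
    refine ⟨_, ?_, D.cheb (g.comp f) (f.comp g) hA hB ?_ ?_⟩
    · exact div_ne_zero (lc_ne (hB ▸ hA)) (lc_ne hA)
    · intro z; rw [eval_comp, hgK, hfK]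
    · intro z; rw [eval_comp, hfK, hgK]
  have comm : ∀ z, f.eval (g.eval z) = γ * g.eval (f.eval z) := by
    intro z
    have := congrArg (eval z) hcomm
    simpa using this
  have hγK : ∀ w, γ * w ∈ K ↔ w ∈ K := by
    intro w
    obtain ⟨y, rfl⟩ := eval_surj g hg w
    obtain ⟨z, rfl⟩ := eval_surj f hf y
    rw [← comm, hfK, hgK, hgK, hfK]
  have hrot : ∀ p : ℂ[X], 0 < p.natDegree → (∀ z, p.eval z ∈ K ↔ z ∈ K) →
      p.comp (C γ * X) = C (γ ^ p.natDegree) * p := by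
    intro p hp hpK
    have hd : (p.comp (C γ * X)).natDegree = p.natDegree := by
      rw [natDegree_comp, natDegree_C_mul_X _ hγ0, mul_one]
    have h1 := D.cheb p (p.comp (C γ * X)) hp hd hpK (by
      intro z
      rw [eval_comp, hpK]
      simpa using hγK z)
    rw [h1]
    congr 2
    rw [leadingCoeff_comp (by rw [natDegree_C_mul_X _ hγ0]; norm_num), leadingCoeff_C_mul_X]
    have := lc_ne hp
    field_simp
  have hrote : ∀ p : ℂ[X], 0 < p.natDegree → (∀ z, p.eval z ∈ K ↔ z ∈ K) →
      ∀ z, p.eval (γ * z) = γ ^ p.natDegree * p.eval z := by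
    intro p hp hpK z
    have := congrArg (eval z) (hrot p hp hpK)
    simpa using this
  have rotf := hrote f hf hfK
  have rotg := hrote g hg hgK
  suffices hM : ∃ M, 0 < M ∧ γ ^ M = 1 by
    obtain ⟨M, hM, hγ⟩ := hM
    exact ⟨γ, M, ⟨hM, hγ, hf, hg, comm, rotf, rotg⟩⟩
  have hmono : ∀ p : ℂ[X], 0 < p.natDegree → (∀ z, p.eval z ∈ K ↔ z ∈ K) →
      (∃ M, 0 < M ∧ γ ^ M = 1) ∨ p = C p.leadingCoeff * X ^ p.natDegree := by
    intro p hp hpK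
    by_cases h : ∃ i < p.natDegree, p.coeff i ≠ 0
    · left
      obtain ⟨i, hi, hci⟩ := h
      refine ⟨p.natDegree - i, by omega, ?_⟩
      have := congrArg (fun q => q.coeff i) (hrot p hp hpK)
      simp only [comp_C_mul_X_coeff, coeff_C_mul] at this
      rw [mul_comm] at this
      have h2 := mul_right_cancel₀ hci this
      rw [pow_sub₀ _ hγ0 hi.le, ← h2]
      exact mul_inv_cancel₀ (pow_ne_zero _ hγ0)
    · right
      push Not at h
      ext i
      rw [coeff_C_mul, coeff_X_pow]
      split_ifs with hi
      · rw [hi, mul_one, coeff_natDegree]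
      · rw [mul_zero]
        rcases lt_or_gt_of_ne hi with hlt | hgt
        · exact h i hlt
        · exact coeff_eq_zero_of_natDegree_lt hgt
  rcases hmono f hf hfK with h | hfm
  · exact h
  rcases hmono g hg hgK with h | hgm
  · exact h
  have lf := lc_ne hf
  have lg := lc_ne hg
  have fe : ∀ z, f.eval z = f.leadingCoeff * z ^ f.natDegree := by
    intro z
    have := congrArg (eval z) hfm
    simpa using this
  have ge : ∀ z, g.eval z = g.leadingCoeff * z ^ g.natDegree := by
    intro z
    have := congrArg (eval z) hgm
    simpa using this
  obtain ⟨p, hp⟩ := IsAlgClosed.exists_pow_nat_eq (f.leadingCoeff)⁻¹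
    (show 0 < f.natDegree - 1 by omega)
  have hp0 : p ≠ 0 := by
    rintro rfl
    rw [zero_pow (by omega)] at hp
    exact inv_ne_zero lf hp.symm
  have hfp : f.eval p = p := by
    rw [fe]
    obtain ⟨k, hk⟩ : ∃ k, f.natDegree = k + 1 := ⟨f.natDegree - 1, by omega⟩
    rw [hk, Nat.add_sub_cancel] at hp
    rw [hk, pow_succ, hp, ← mul_assoc, mul_inv_cancel₀ lf, one_mul]
  have hfin := hprep p (by
    refine (Set.finite_singleton p).subset ?_
    rintro _ ⟨n, rfl⟩
    exact Function.iterate_fixed hfp n)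
  have hu0 : ∀ n, (it g n).eval p ≠ 0 := by
    intro n
    induction n with
    | zero => simpa [it] using hp0
    | succ n ih =>
      rw [it_eval, Function.iterate_succ_apply', ← it_eval, ge]
      exact mul_ne_zero lg (pow_ne_zero _ ih)
  have hfu : ∀ n, f.eval ((it g n).eval p) = γ ^ (gs g.natDegree n) * (it g n).eval p := by
    intro n
    induction n with
    | zero => simpa [it, gs] using hfp
    | succ n ih =>
      rw [it_eval, Function.iterate_succ_apply', comm, ← it_eval, ih, rot_pow g _ rotg, gs_succ]
      ring
  have hninj : ¬ Function.Injective (fun n : ℕ => (fun y => g.eval y)^[n] p) := by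
    intro hinj
    exact Set.infinite_range_of_injective hinj hfin
  have : ∃ m n : ℕ, m < n ∧ (it g m).eval p = (it g n).eval p := by
    simp only [Function.Injective, not_forall] at hninj
    obtain ⟨m, n, h1, h2⟩ := hninj
    rw [← it_eval, ← it_eval] at h1
    rcases lt_or_gt_of_ne h2 with h | h
    · exact ⟨m, n, h, h1⟩
    · exact ⟨n, m, h, h1.symm⟩
  obtain ⟨m, n, hmn, he⟩ := this
  have h1 := hfu m
  rw [he, hfu n] at h1
  have h2 := mul_right_cancel₀ (hu0 n) h1
  have hlt := gs_strictMono g.natDegree hg hmn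
  refine ⟨gs g.natDegree n - gs g.natDegree m, by omega, ?_⟩
  rw [pow_sub₀ _ hγ0 hlt.le, h2]
  exact mul_inv_cancel₀ (pow_ne_zero _ hγ0)

lemma exists_disc (K : Set ℂ) (hK : IsCompact K) (x y : ℂ) (hx : x ∈ K) (hy : y ∈ K)
    (hxy : x ≠ y) : ∃ ζ R, Disc {z | z + ζ ∈ K} R := by
  obtain ⟨B, hB⟩ := hK.isBounded.exists_norm_le
  have hB0 : 0 ≤ B := (norm_nonneg x).trans (hB x hx)
  -- the minimal enclosing disc
  let E : Set (ℂ × ℝ) := (Metric.closedBall 0 (2 * B) ×ˢ Set.Icc 0 B) ∩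
    {p | ∀ w ∈ K, ‖w - p.1‖ ≤ p.2}
  have hEc : IsCompact E := by
    apply IsCompact.inter_right
    · exact (isCompact_closedBall _ _).prod isCompact_Icc
    · have : {p : ℂ × ℝ | ∀ w ∈ K, ‖w - p.1‖ ≤ p.2} = ⋂ w ∈ K, {p : ℂ × ℝ | ‖w - p.1‖ ≤ p.2} := by
        ext p; simp
      rw [this]
      refine isClosed_biInter fun w _ => isClosed_le (by fun_prop) (by fun_prop)
  have hEne : E.Nonempty := by
    refine ⟨(0, B), ⟨⟨?_, ?_⟩, ?_⟩⟩
    · simp [hB0]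
    · simp [hB0]
    · intro w hw
      simpa using hB w hw
  obtain ⟨⟨ζ, R⟩, hE, hmin⟩ := hEc.exists_isMinOn hEne continuous_snd.continuousOn
  have hin : ∀ w ∈ K, ‖w - ζ‖ ≤ R := hE.2
  have hRB : R ≤ B := hE.1.2.2
  have hmin' : ∀ c r, (∀ w ∈ K, ‖w - c‖ ≤ r) → R ≤ r := by
    intro c r h
    rcases le_or_gt r B with hr | hr
    · have hr0 : 0 ≤ r := (norm_nonneg _).trans (h x hx)
      have hmem : (c, r) ∈ E := by
        refine ⟨⟨?_, hr0, hr⟩, h⟩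
        rw [mem_closedBall_zero_iff]
        have h1 := h x hx
        have h2 := hB x hx
        have h3 : ‖c‖ ≤ ‖x - c‖ + ‖x‖ := by
          rw [norm_sub_rev]
          have := norm_add_le (c - x) x
          simpa using this
        simp only
        linarith
      exact hmin hmem
    · linarith
  have hR0 : 0 < R := by
    by_contra hcon
    have h1 := hin x hx
    have h2 := hin y hy
    have h3 : x - ζ = 0 := norm_le_zero_iff.mp (by linarith)
    have h4 : y - ζ = 0 := norm_le_zero_iff.mp (by linarith)
    exact hxy ((sub_eq_zero.mp h3).trans (sub_eq_zero.mp h4).symm)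
  have hbd : ∀ w ∈ {z | z + ζ ∈ K}, ‖w‖ ≤ R := by
    intro w hw
    simpa using hin _ hw
  have hmin2 : ∀ t r, (∀ w ∈ {z | z + ζ ∈ K}, ‖w + t‖ ≤ r) → R ≤ r := by
    intro t r h
    apply hmin' (ζ - t) r
    intro w hw
    have := h (w - ζ) (by simpa using hw)
    convert this using 2
    ring
  set K' := {z | z + ζ ∈ K} with hK'
  have hK'c : IsCompact K' := by
    have : K' = (Homeomorph.addRight ζ) ⁻¹' K := rfl
    rw [this]
    exact (Homeomorph.addRight ζ).isCompact_preimage.mpr hK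
  have hK'ne : K'.Nonempty := ⟨x - ζ, by simpa [hK'] using hx⟩
  have huniq : ∀ t : ℂ, (∀ w ∈ K', ‖w + t‖ ≤ R) → t = 0 := by
    intro t ht
    by_contra hne
    have ht0 : 0 < ‖t‖ := norm_pos_iff.mpr hne
    have h1 : R ≤ Real.sqrt (R ^ 2 - ‖t‖ ^ 2 / 4) := by
      apply hmin2 (t / 2)
      intro w hw
      apply Real.le_sqrt_of_sq_le
      have p1 := parallelogram_law_with_norm ℝ (w + t / 2) (t / 2)
      have e1 : w + t / 2 + t / 2 = w + t := by ring
      have e2 : w + t / 2 - t / 2 = w := by ring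
      rw [e1, e2] at p1
      have e3 : ‖t / 2‖ = ‖t‖ / 2 := by simp
      rw [e3] at p1
      have b1 := pow_le_pow_left₀ (norm_nonneg _) (hbd w hw) 2
      have b2 := pow_le_pow_left₀ (norm_nonneg _) (ht w hw) 2
      nlinarith
    have h2 : Real.sqrt (R ^ 2 - ‖t‖ ^ 2 / 4) < R := by
      rw [Real.sqrt_lt' hR0]
      have : 0 < ‖t‖ ^ 2 := by positivity
      linarith
    linarith
  refine ⟨ζ, R, ⟨hbd, huniq, ?_⟩⟩
  obtain ⟨w1, hw1, hmax⟩ := hK'c.exists_isMaxOn hK'ne continuous_norm.continuousOn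
  have hw1R : ‖w1‖ = R := by
    apply le_antisymm (hbd w1 hw1)
    apply hmin2 0
    intro w hw
    rw [add_zero]
    exact hmax hw
  have hw10 : w1 ≠ 0 := by
    rintro rfl
    simp at hw1R
    linarith
  have hex : ∀ k : ℕ, ∃ w ∈ K', R < ‖w + -(w1 / (k + 1))‖ := by
    intro k
    by_contra hcon
    push Not at hcon
    have := huniq _ hcon
    rw [neg_eq_zero, div_eq_zero_iff] at this
    rcases this with h | h
    · exact hw10 h
    · exact Nat.cast_add_one_ne_zero k h
  choose w hwK hw using hex
  obtain ⟨w2, hw2, φ, hφ, hlim⟩ := hK'c.tendsto_subseq hwK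
  have hs : Tendsto (fun k : ℕ => ((1 : ℝ) / ((φ k : ℝ) + 1))) atTop (𝓝 0) :=
    tendsto_one_div_add_atTop_nhds_zero_nat.comp hφ.tendsto_atTop
  have hsc : Tendsto (fun k : ℕ => w1 / ((φ k : ℂ) + 1)) atTop (𝓝 0) := by
    have h1 : Tendsto (fun k : ℕ => w1 * (((1 : ℝ) / ((φ k : ℝ) + 1) : ℝ) : ℂ)) atTop
        (𝓝 (w1 * ((0 : ℝ) : ℂ))) :=
      tendsto_const_nhds.mul ((Complex.continuous_ofReal.tendsto 0).comp hs)
    rw [Complex.ofReal_zero, mul_zero] at h1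
    refine h1.congr fun k => ?_
    push_cast
    ring
  have hw2R : ‖w2‖ = R := by
    apply le_antisymm (hbd w2 hw2)
    have h1 : Tendsto (fun k => ‖w (φ k) + -(w1 / ((φ k : ℂ) + 1))‖) atTop (𝓝 ‖w2 + -0‖) :=
      (hlim.add hsc.neg).norm
    rw [neg_zero, add_zero] at h1
    exact ge_of_tendsto' h1 fun k => (hw (φ k)).le
  have hre : (w2 * (starRingEnd ℂ) w1).re ≤ 0 := by
    have h1 : Tendsto (fun k => 2 * (w (φ k) * (starRingEnd ℂ) w1).re) atTop
        (𝓝 (2 * (w2 * (starRingEnd ℂ) w1).re)) :=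
      ((Complex.continuous_re.tendsto _).comp (hlim.mul_const _)).const_mul 2
    have h2 : Tendsto (fun k : ℕ => ((1 : ℝ) / ((φ k : ℝ) + 1)) * R ^ 2) atTop (𝓝 (0 * R ^ 2)) :=
      hs.mul_const _
    have h3 := le_of_tendsto_of_tendsto' h1 h2 (by
      intro k
      have a1 := hw (φ k)
      have a2 := hbd _ (hwK (φ k))
      set s : ℝ := (1 : ℝ) / ((φ k : ℝ) + 1) with hsdef
      have hs0 : 0 < s := by positivity
      have e : w (φ k) + -(w1 / ((φ k : ℂ) + 1)) = w (φ k) - s * w1 := by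
        rw [hsdef]
        push_cast
        ring
      rw [e] at a1
      have a3 : R ^ 2 < ‖w (φ k) - s * w1‖ ^ 2 := pow_lt_pow_left₀ a1 hR0.le (by norm_num)
      rw [← Complex.normSq_eq_norm_sq, Complex.normSq_sub, Complex.normSq_eq_norm_sq,
        Complex.normSq_eq_norm_sq, norm_mul, hw1R, map_mul, Complex.conj_ofReal,
        Complex.norm_real, Real.norm_of_nonneg hs0.le] at a3
      have e2 : (w (φ k) * (s * (starRingEnd ℂ) w1)).re = s * (w (φ k) * (starRingEnd ℂ) w1).re := by
        rw [mul_left_comm, Complex.re_ofReal_mul]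
      rw [e2] at a3
      have a4 := pow_le_pow_left₀ (norm_nonneg _) a2 2
      have a5 : s * (2 * (w (φ k) * (starRingEnd ℂ) w1).re) ≤ s * (s * R ^ 2) := by nlinarith
      exact le_of_mul_le_mul_left a5 hs0)
    linarith
  refine ⟨w1, hw1, w2, hw2, ?_, hw1R, hw2R⟩
  rintro rfl
  rw [Complex.mul_conj, Complex.normSq_eq_norm_sq, hw1R, Complex.ofReal_re] at hre
  have : 0 < R ^ 2 := by positivity
  linarith

end Stmt15

namespace Stmt15

lemma prep_iff (φ : ℂ → ℂ) (x : ℂ) : (Set.range fun n : ℕ => φ^[n] (φ x)).Finite ↔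
    (Set.range fun n : ℕ => φ^[n] x).Finite := by
  constructor
  · intro h
    refine (h.insert x).subset ?_
    rintro _ ⟨n, rfl⟩
    cases n with
    | zero => exact Or.inl rfl
    | succ n => exact Or.inr ⟨n, rfl⟩
  · intro h
    refine h.subset ?_
    rintro _ ⟨n, rfl⟩
    exact ⟨n + 1, rfl⟩

lemma prep_fixed (φ : ℂ → ℂ) (x : ℂ) (h : φ x = x) :
    (Set.range fun n : ℕ => φ^[n] x).Finite := by
  refine (Set.finite_singleton x).subset ?_
  rintro _ ⟨n, rfl⟩
  exact Function.iterate_fixed h n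

lemma growth (f : ℂ[X]) (hf : 2 ≤ f.natDegree) :
    ∃ r : ℝ, ∀ z, r ≤ ‖z‖ → ‖z‖ + 1 ≤ ‖f.eval z‖ := by
  have hd : 0 < f.divX.degree := by
    rw [← natDegree_pos_iff_degree_pos, natDegree_divX_eq_natDegree_tsub_one]; omega
  have h1 : ∀ᶠ z in Bornology.cobounded ℂ, (2 : ℝ) ≤ ‖f.divX.eval z‖ :=
    (f.divX.tendsto_norm_atTop hd tendsto_norm_cobounded_atTop).eventually_ge_atTop 2
  rw [← comap_norm_atTop, eventually_comap] at h1
  obtain ⟨r, hr⟩ := eventually_atTop.1 h1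
  refine ⟨max r (‖f.coeff 0‖ + 1), fun z hz => ?_⟩
  have h2 := hr ‖z‖ ((le_max_left _ _).trans hz) z rfl
  have h3 := (le_max_right _ _).trans hz
  have h4 : f.eval z = f.divX.eval z * z + f.coeff 0 := by
    conv_lhs => rw [← divX_mul_X_add f]
    simp
  have h5 : ‖f.divX.eval z * z‖ ≤ ‖f.eval z‖ + ‖f.coeff 0‖ := by
    have : f.divX.eval z * z = f.eval z - f.coeff 0 := by rw [h4]; ring
    rw [this]; exact norm_sub_le _ _
  rw [norm_mul] at h5
  nlinarith [norm_nonneg z]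

lemma prep_bounded (f : ℂ[X]) (hf : 2 ≤ f.natDegree) :
    Bornology.IsBounded {x : ℂ | (Set.range fun n : ℕ => (fun y => f.eval y)^[n] x).Finite} := by
  obtain ⟨r, hr⟩ := growth f hf
  rw [isBounded_iff_forall_norm_le]
  refine ⟨r, fun x hx => ?_⟩
  by_contra! hlt
  have h1 : ∀ n : ℕ, ‖x‖ + n ≤ ‖(fun y => f.eval y)^[n] x‖ := by
    intro n
    induction n with
    | zero => simp
    | succ n ih =>
      rw [Function.iterate_succ_apply']
      have hn : (0 : ℝ) ≤ n := n.cast_nonneg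
      have := hr ((fun y => f.eval y)^[n] x) (by linarith)
      push_cast
      linarith
  obtain ⟨B, hB⟩ := isBounded_iff_forall_norm_le.1 (Set.Finite.isBounded hx)
  obtain ⟨n, hn⟩ := exists_nat_gt B
  have h2 := h1 n
  have h3 := hB _ ⟨n, rfl⟩
  have h4 := norm_nonneg x
  simp only at h3
  linarith

lemma eq_of_roots (p : ℂ[X]) (a : ℂ) (h : ∀ z, p.eval z = 0 → z = a) (hp : p ≠ 0) :
    p = C p.leadingCoeff * (X - C a) ^ p.natDegree := by
  have hs : p.Splits := IsAlgClosed.splits p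
  have hr : p.roots = Multiset.replicate p.natDegree a := by
    rw [Multiset.eq_replicate]
    refine ⟨hs.natDegree_eq_card_roots.symm, fun b hb => h b ?_⟩
    exact (mem_roots hp).1 hb
  conv_lhs => rw [hs.eq_prod_roots, hr]
  simp

lemma prep_two (f : ℂ[X]) (hf : 2 ≤ f.natDegree) :
    ∃ x y : ℂ, (Set.range fun n : ℕ => (fun y => f.eval y)^[n] x).Finite ∧
      (Set.range fun n : ℕ => (fun y => f.eval y)^[n] y).Finite ∧ x ≠ y := by
  have hX : (X : ℂ[X]).natDegree < f.natDegree := by rw [natDegree_X]; omega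
  have hdX : (f - X).natDegree = f.natDegree := natDegree_sub_eq_left_of_natDegree_lt hX
  obtain ⟨a, ha⟩ := eval_surj (f - X) (by omega) 0
  have ha' : f.eval a = a := by simpa [sub_eq_zero] using ha
  have hPa := prep_fixed (fun y => f.eval y) a ha'
  by_contra! hcon
  have hP : ∀ z, (Set.range fun n : ℕ => (fun y => f.eval y)^[n] z).Finite → z = a :=
    fun z hz => hcon z a hz hPa
  have hC : (C a : ℂ[X]).natDegree < f.natDegree := by rw [natDegree_C]; omega
  have hdC : (f - C a).natDegree = f.natDegree := natDegree_sub_eq_left_of_natDegree_lt hC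
  have hlX : (f - X).leadingCoeff = f.leadingCoeff :=
    leadingCoeff_sub_of_degree_lt (degree_lt_degree hX)
  have hlC : (f - C a).leadingCoeff = f.leadingCoeff :=
    leadingCoeff_sub_of_degree_lt (degree_lt_degree hC)
  have e1 := eq_of_roots (f - X) a (fun z hz => hP z (prep_fixed _ z (by
    simpa [sub_eq_zero] using hz))) (by intro h; rw [h, natDegree_zero] at hdX; omega)
  have e2 := eq_of_roots (f - C a) a (fun z hz => hP z (by
    rw [← prep_iff]
    have : f.eval z = a := by simpa [sub_eq_zero] using hz
    simp only [this]
    exact hPa)) (by intro h; rw [h, natDegree_zero] at hdC; omega)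
  rw [hdX, hlX] at e1
  rw [hdC, hlC, ← e1] at e2
  have e3 := congrArg (eval (a + 1)) e2
  simp at e3

/-- Conjugate by a translation. -/
lemma conj_natDegree (f : ℂ[X]) (ζ : ℂ) :
    (f.comp (X + C ζ) - C ζ).natDegree = f.natDegree := by
  rw [natDegree_sub_C, natDegree_comp, natDegree_X_add_C, mul_one]

lemma conj_eval (f : ℂ[X]) (ζ z : ℂ) :
    (f.comp (X + C ζ) - C ζ).eval z = f.eval (z + ζ) - ζ := by simp [eval_comp]

lemma conj_iter (f : ℂ[X]) (ζ z : ℂ) (n : ℕ) :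
    (fun y => (f.comp (X + C ζ) - C ζ).eval y)^[n] z = (fun y => f.eval y)^[n] (z + ζ) - ζ := by
  induction n with
  | zero => simp
  | succ n ih => rw [Function.iterate_succ_apply', ih, conj_eval, Function.iterate_succ_apply']; simp

lemma conj_prep (f : ℂ[X]) (ζ z : ℂ) :
    (Set.range fun n : ℕ => (fun y => (f.comp (X + C ζ) - C ζ).eval y)^[n] z).Finite ↔
    (Set.range fun n : ℕ => (fun y => f.eval y)^[n] (z + ζ)).Finite := by
  have : (Set.range fun n : ℕ => (fun y => (f.comp (X + C ζ) - C ζ).eval y)^[n] z) =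
      (fun w => w - ζ) '' (Set.range fun n : ℕ => (fun y => f.eval y)^[n] (z + ζ)) := by
    rw [← Set.range_comp]
    congr 1
    funext n
    exact conj_iter f ζ z n
  rw [this]
  exact Set.finite_image_iff (fun x _ y _ h => sub_left_injective h)

lemma closure_inv (f : ℂ[X]) (hf : 0 < f.natDegree) (P : Set ℂ)
    (hP : ∀ z, f.eval z ∈ P ↔ z ∈ P) (z : ℂ) : f.eval z ∈ closure P ↔ z ∈ closure P := by
  have ho := f.isOpenQuotientMap_eval (by omega)
  have h1 := ho.isOpenMap.preimage_closure_eq_closure_preimage ho.continuous P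
  have h2 : (fun y => f.eval y) ⁻¹' P = P := Set.ext hP
  have h3 : (fun y => f.eval y) ⁻¹' closure P = closure P := by
    rw [← h2]
    refine Eq.trans ?_ h1
    rw [h2]
  exact Set.ext_iff.1 h3 z

lemma main (f g : ℂ[X]) (hf : 2 ≤ f.natDegree) (hg : 0 < g.natDegree)
    (hprep : {x : ℂ | (Set.range fun n : ℕ => (fun y => f.eval y)^[n] x).Finite} =
             {x : ℂ | (Set.range fun n : ℕ => (fun y => g.eval y)^[n] x).Finite}) (c : ℂ) :
    IsAPU {n : ℕ | ∃ x : ℂ, (fun y => f.eval y)^[n] x = c ∧ (fun y => g.eval y)^[n] x = c} := by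
  obtain ⟨x, y, hx, hy, hxy⟩ := prep_two f hf
  set P := {x : ℂ | (Set.range fun n : ℕ => (fun y => f.eval y)^[n] x).Finite} with hPdef
  have hK : IsCompact (closure P) := (prep_bounded f hf).isCompact_closure
  have hfP : ∀ z, f.eval z ∈ P ↔ z ∈ P := fun z => prep_iff (fun y => f.eval y) z
  have hgP : ∀ z, g.eval z ∈ P ↔ z ∈ P := by
    rw [hprep]; exact fun z => prep_iff (fun y => g.eval y) z
  obtain ⟨ζ, R, D⟩ := exists_disc (closure P) hK x y (subset_closure hx) (subset_closure hy) hxy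
  obtain ⟨γ, M, S⟩ := D.setting (f.comp (X + C ζ) - C ζ) (g.comp (X + C ζ) - C ζ)
    (by rw [conj_natDegree]; exact hf) (by rw [conj_natDegree]; exact hg)
    (fun z => by
      rw [conj_eval]
      simp only [Set.mem_setOf_eq, sub_add_cancel]
      exact closure_inv f (by omega) P hfP _)
    (fun z => by
      rw [conj_eval]
      simp only [Set.mem_setOf_eq, sub_add_cancel]
      exact closure_inv g hg P hgP _)
    (fun z hz => by
      rw [conj_prep] at hz ⊢
      have : z + ζ ∈ P := hz
      rw [hprep] at this
      exact this)
  have hA := S.apu (by rw [conj_natDegree]; exact hf) (c - ζ)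
  convert hA using 1
  ext n
  simp only [Set.mem_setOf_eq, it_eval, conj_iter, sub_left_inj]
  constructor
  · rintro ⟨x, h1, h2⟩
    exact ⟨x - ζ, by simpa using h1, by simpa using h2⟩
  · rintro ⟨x, h1, h2⟩
    exact ⟨x + ζ, h1, h2⟩

lemma iter_const (f : ℂ[X]) (a : ℂ) (h : f = C a) (n : ℕ) (x : ℂ) :
    (fun y => f.eval y)^[n + 1] x = a := by
  rw [Function.iterate_succ_apply', h, eval_C]

lemma const_case (f g : ℂ[X]) (hf : f.natDegree = 0) (hne : f ≠ g) (c : ℂ) :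
    IsAPU {n : ℕ | ∃ x : ℂ, (fun y => f.eval y)^[n] x = c ∧ (fun y => g.eval y)^[n] x = c} := by
  obtain ⟨a, ha⟩ := natDegree_eq_zero.1 hf
  rcases Nat.eq_zero_or_pos g.natDegree with hg | hg
  · obtain ⟨b, hb⟩ := natDegree_eq_zero.1 hg
    convert IsAPU.singleton 0 using 1
    ext n
    cases n with
    | zero => simp
    | succ n =>
      simp only [iter_const f a ha.symm, iter_const g b hb.symm, Set.mem_setOf_eq]
      constructor
      · rintro ⟨x, h1, h2⟩
        exact absurd (by rw [← ha, ← hb, h1, h2]) hne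
      · intro h; simp at h
  · by_cases hac : a = c
    · convert IsAPU.univ using 1
      ext n
      simp only [Set.mem_setOf_eq, Set.mem_univ, iff_true]
      cases n with
      | zero => exact ⟨c, rfl, rfl⟩
      | succ n =>
        have hs : Function.Surjective (fun y => g.eval y) := fun w => eval_surj g hg w
        obtain ⟨x, hx⟩ := hs.iterate (n + 1) c
        exact ⟨x, by rw [iter_const f a ha.symm, hac], hx⟩
    · convert IsAPU.singleton 0 using 1
      ext n
      cases n with
      | zero => simp
      | succ n =>
        simp only [iter_const f a ha.symm, Set.mem_setOf_eq]
        constructor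
        · rintro ⟨x, h1, h2⟩
          exact absurd h1 hac
        · intro h; simp at h

lemma final (f g : ℂ[X]) (hdeg : f.degree ≠ g.degree)
    (hprep : {x : ℂ | (Set.range fun n : ℕ => (fun y => f.eval y)^[n] x).Finite} =
             {x : ℂ | (Set.range fun n : ℕ => (fun y => g.eval y)^[n] x).Finite}) (c : ℂ) :
    IsAPU {n : ℕ | ∃ x : ℂ, (fun y => f.eval y)^[n] x = c ∧ (fun y => g.eval y)^[n] x = c} := by
  have hne : f ≠ g := fun h => hdeg (by rw [h])
  have hsymm : {n : ℕ | ∃ x : ℂ, (fun y => f.eval y)^[n] x = c ∧ (fun y => g.eval y)^[n] x = c} =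
      {n : ℕ | ∃ x : ℂ, (fun y => g.eval y)^[n] x = c ∧ (fun y => f.eval y)^[n] x = c} := by
    ext n; simp only [Set.mem_setOf_eq, and_comm]
  rcases Nat.eq_zero_or_pos f.natDegree with hf | hf
  · exact const_case f g hf hne c
  rcases Nat.eq_zero_or_pos g.natDegree with hg | hg
  · rw [hsymm]; exact const_case g f hg hne.symm c
  have hnd : f.natDegree ≠ g.natDegree := by
    intro h
    apply hdeg
    rw [degree_eq_natDegree (by rintro rfl; simp at hf), h,
      degree_eq_natDegree (by rintro rfl; simp at hg)]
  by_cases h2 : 2 ≤ f.natDegree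
  · exact main f g h2 hg hprep c
  · rw [hsymm]
    exact main g f (by omega) hf hprep.symm c

end Stmt15

end Helpers


/-- Proposition 4.7: the case of a constant preperiodic target `c`. -/
theorem stmt15 (f g : Polynomial ℂ) (hdeg : f.degree ≠ g.degree)
    (hprep : {x : ℂ | (Set.range fun n : ℕ => (fun y => f.eval y)^[n] x).Finite} =
             {x : ℂ | (Set.range fun n : ℕ => (fun y => g.eval y)^[n] x).Finite})
    (c : ℂ) (hc : (Set.range fun n : ℕ => (fun y => f.eval y)^[n] c).Finite) :
    ∃ s : Finset (ℕ × ℕ),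
      {n : ℕ | ∃ x : ℂ,
        (fun y => f.eval y)^[n] x = c ∧ (fun y => g.eval y)^[n] x = c} =
      ⋃ p ∈ s, {n : ℕ | ∃ k : ℕ, n = p.1 + p.2 * k} := by
  exact Stmt15.final f g hdeg hprep c
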